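/- The integral ((A+B+2)/2) ∫_{ζ₋}^{ζ₊} R(t)/(t²−1) dt takes the following values depending on the path from ζ₋ to ζ₊: it equals πi(1+B) along Γ_R; it equals πi(1+A+B) along Γ_C traversed from ζ₋ to ζ₊ with R replaced by its boundary value R₊ from the + side; it equals −πi(1+A+B) along Γ_C traversed from ζ₋ to ζ₊ with boundary value R₋ from the − side; and it equals −πi(1+A) along Γ_L traversed from ζ₋ to ζ₊. -/

import Mathlib

open Complex Set Filter Topology Bornology

noncomputable section

/-- The branch point `ζ₊`. -/
def zetaP (A B : ℝ) : ℂ :=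
  (((B : ℂ) ^ 2 - (A : ℂ) ^ 2) +
      4 * Complex.I * ((Real.sqrt ((A + 1) * (B + 1) * (-A - B - 1)) : ℝ) : ℂ)) /
    ((A : ℂ) + (B : ℂ) + 2) ^ 2

/-- The branch point `ζ₋`. -/
def zetaM (A B : ℝ) : ℂ :=
  (((B : ℂ) ^ 2 - (A : ℂ) ^ 2) -
      4 * Complex.I * ((Real.sqrt ((A + 1) * (B + 1) * (-A - B - 1)) : ℝ) : ℂ)) /
    ((A : ℂ) + (B : ℂ) + 2) ^ 2

/-- The set `Γ = { z : Re ∫_{ζ₋}^z ((t−ζ₊)(t−ζ₋))^{1/2}/(t²−1) dt = 0 }`. -/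
def GammaSet (A B : ℝ) : Set ℂ :=
  {z | ∃ γ g : ℝ → ℂ, ContDiff ℝ 1 γ ∧ γ 0 = zetaM A B ∧ γ 1 = z ∧
    (∀ t ∈ Set.Icc (0 : ℝ) 1, γ t ≠ 1 ∧ γ t ≠ -1) ∧
    ContinuousOn g (Set.Icc 0 1) ∧
    (∀ t ∈ Set.Icc (0 : ℝ) 1, g t ^ 2 = (γ t - zetaP A B) * (γ t - zetaM A B)) ∧
    (∫ t in (0:ℝ)..1, g t / ((γ t) ^ 2 - 1) * deriv γ t).re = 0}

/-- `γL, γC, γR` are injective regular C¹ parametrizations of the three arcs of `Γ`,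
with the orientation of the paper: `Γ_L`, `Γ_C` run from `ζ₊` to `ζ₋`, and `Γ_R` from
`ζ₋` to `ζ₊`; `Γ_L`, `Γ_C`, `Γ_R` cross the real line in `(−∞,−1)`, `(−1,1)`, `(1,∞)`
respectively, and their union is `Γ`. -/
structure ArcParam (A B : ℝ) (γL γC γR : ℝ → ℂ) : Prop where
  smoothL : ContDiff ℝ 1 γL
  smoothC : ContDiff ℝ 1 γC
  smoothR : ContDiff ℝ 1 γR
  injL : Set.InjOn γL (Set.Icc 0 1)
  injC : Set.InjOn γC (Set.Icc 0 1)
  injR : Set.InjOn γR (Set.Icc 0 1)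
  regL : ∀ t ∈ Set.Icc (0:ℝ) 1, deriv γL t ≠ 0
  regC : ∀ t ∈ Set.Icc (0:ℝ) 1, deriv γC t ≠ 0
  regR : ∀ t ∈ Set.Icc (0:ℝ) 1, deriv γR t ≠ 0
  endL0 : γL 0 = zetaP A B
  endL1 : γL 1 = zetaM A B
  endC0 : γC 0 = zetaP A B
  endC1 : γC 1 = zetaM A B
  endR0 : γR 0 = zetaM A B
  endR1 : γR 1 = zetaP A B
  union : γL '' Set.Icc 0 1 ∪ γC '' Set.Icc 0 1 ∪ γR '' Set.Icc 0 1 = GammaSet A B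
  crossL : ∀ t ∈ Set.Icc (0:ℝ) 1, (γL t).im = 0 → (γL t).re < -1
  crossC : ∀ t ∈ Set.Icc (0:ℝ) 1, (γC t).im = 0 → -1 < (γC t).re ∧ (γC t).re < 1
  crossR : ∀ t ∈ Set.Icc (0:ℝ) 1, (γR t).im = 0 → 1 < (γR t).re

/-- `R` is the single-valued analytic branch of `((z−ζ₊)(z−ζ₋))^{1/2}` on `ℂ ∖ Γ_C`
with `R(z)/z → 1` as `z → ∞`, where `Γ_C` is the image of `γC`. -/
def IsSqrtBranch (A B : ℝ) (γC : ℝ → ℂ) (R : ℂ → ℂ) : Prop :=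
  DifferentiableOn ℂ R (γC '' Set.Icc 0 1)ᶜ ∧
  (∀ z ∉ γC '' Set.Icc 0 1, R z ^ 2 = (z - zetaP A B) * (z - zetaM A B)) ∧
  Filter.Tendsto (fun z => R z / z) (Bornology.cobounded ℂ) (nhds 1)

/-- `Rp` is the boundary value `R₊` of `R` on the cut `Γ_C`, taken from the `+` side
(the left-hand side with respect to the orientation of `γC`). -/
def IsPlusBoundary (A B : ℝ) (γC : ℝ → ℂ) (R : ℂ → ℂ) (Rp : ℝ → ℂ) : Prop :=
  ContinuousOn Rp (Set.Icc 0 1) ∧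
  (∀ t ∈ Set.Icc (0:ℝ) 1, Rp t ^ 2 = (γC t - zetaP A B) * (γC t - zetaM A B)) ∧
  ∀ t ∈ Set.Ioo (0:ℝ) 1,
    Filter.Tendsto (fun ε : ℝ => R (γC t + (ε : ℂ) * (Complex.I * deriv γC t)))
      (nhdsWithin 0 (Set.Ioi 0)) (nhds (Rp t))

/-- `Rm` is the boundary value `R₋` of `R` on the cut `Γ_C`, taken from the `−` side
(the right-hand side with respect to the orientation of `γC`). -/
def IsMinusBoundary (A B : ℝ) (γC : ℝ → ℂ) (R : ℂ → ℂ) (Rm : ℝ → ℂ) : Prop :=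
  ContinuousOn Rm (Set.Icc 0 1) ∧
  (∀ t ∈ Set.Icc (0:ℝ) 1, Rm t ^ 2 = (γC t - zetaP A B) * (γC t - zetaM A B)) ∧
  ∀ t ∈ Set.Ioo (0:ℝ) 1,
    Filter.Tendsto (fun ε : ℝ => R (γC t + (ε : ℂ) * (Complex.I * deriv γC t)))
      (nhdsWithin 0 (Set.Iio 0)) (nhds (Rm t))


/-- Parameters of the rational uniformization. -/
structure Par (c h ρ1 ρ2 τ1 τ2 : ℝ) : Prop where
  h0 : 0 < h
  t1 : 0 < τ1
  t2 : 0 < τ2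
  e1 : h * (τ1 ^ 2 - 1) = 2 * (1 - c) * τ1
  f1 : h * (τ1 ^ 2 + 1) = 2 * ρ1 * τ1
  e2 : h * (τ2 ^ 2 - 1) = 2 * (-1 - c) * τ2
  f2 : h * (τ2 ^ 2 + 1) = 2 * ρ2 * τ2

def Vs (τ1 τ2 : ℝ) : Set ℝ := {0, τ1, -1 / τ1, τ2, -1 / τ2}

def SC (ρ1 ρ2 τ1 τ2 : ℝ) (f : ℝ → ℂ) : ℂ :=
  f 0 + (ρ1 : ℂ) / 2 * (f τ1 - f (-1 / τ1)) - (ρ2 : ℂ) / 2 * (f τ2 - f (-1 / τ2))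

def SR (ρ1 ρ2 τ1 τ2 : ℝ) (f : ℝ → ℝ) : ℝ :=
  f 0 + ρ1 / 2 * (f τ1 - f (-1 / τ1)) - ρ2 / 2 * (f τ2 - f (-1 / τ2))

lemma Vs_forall {τ1 τ2 : ℝ} {P : ℝ → Prop} :
    (∀ v ∈ Vs τ1 τ2, P v) ↔ P 0 ∧ P τ1 ∧ P (-1 / τ1) ∧ P τ2 ∧ P (-1 / τ2) := by
  simp [Vs]

lemma SC_re (ρ1 ρ2 τ1 τ2 : ℝ) (f : ℝ → ℂ) :
    (SC ρ1 ρ2 τ1 τ2 f).re = SR ρ1 ρ2 τ1 τ2 (fun v => (f v).re) := by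
  have h : ∀ r : ℝ, (r : ℂ) / 2 = ((r / 2 : ℝ) : ℂ) := by intro r; push_cast; rfl
  simp only [SC, SR, h, Complex.add_re, Complex.sub_re, Complex.re_ofReal_mul]

lemma SR_sub (ρ1 ρ2 τ1 τ2 : ℝ) (f g : ℝ → ℝ) :
    SR ρ1 ρ2 τ1 τ2 (fun v => f v - g v) = SR ρ1 ρ2 τ1 τ2 f - SR ρ1 ρ2 τ1 τ2 g := by
  simp only [SR]; ring

lemma SC_sub (ρ1 ρ2 τ1 τ2 : ℝ) (f g : ℝ → ℂ) :
    SC ρ1 ρ2 τ1 τ2 (fun v => f v - g v) = SC ρ1 ρ2 τ1 τ2 f - SC ρ1 ρ2 τ1 τ2 g := by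
  simp only [SC]; ring

lemma SC_mul (ρ1 ρ2 τ1 τ2 : ℝ) (f : ℝ → ℂ) (a : ℂ) :
    SC ρ1 ρ2 τ1 τ2 (fun v => f v * a) = SC ρ1 ρ2 τ1 τ2 f * a := by
  simp only [SC]; ring

lemma SC_congr {ρ1 ρ2 τ1 τ2 : ℝ} {f g : ℝ → ℂ} (h : ∀ v ∈ Vs τ1 τ2, f v = g v) :
    SC ρ1 ρ2 τ1 τ2 f = SC ρ1 ρ2 τ1 τ2 g := by
  rw [Vs_forall] at h
  obtain ⟨a, b, c, d, e⟩ := h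
  simp only [SC, a, b, c, d, e]

lemma SR_congr {ρ1 ρ2 τ1 τ2 : ℝ} {f g : ℝ → ℝ} (h : ∀ v ∈ Vs τ1 τ2, f v = g v) :
    SR ρ1 ρ2 τ1 τ2 f = SR ρ1 ρ2 τ1 τ2 g := by
  rw [Vs_forall] at h
  obtain ⟨a, b, c, d, e⟩ := h
  simp only [SR, a, b, c, d, e]

lemma SC_hasDerivAt {𝕜 : Type*} [NontriviallyNormedField 𝕜] [NormedAlgebra 𝕜 ℂ]
    {ρ1 ρ2 τ1 τ2 : ℝ} {f : ℝ → 𝕜 → ℂ} {f' : ℝ → ℂ} {x : 𝕜}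
    (h : ∀ v ∈ Vs τ1 τ2, HasDerivAt (f v) (f' v) x) :
    HasDerivAt (fun y => SC ρ1 ρ2 τ1 τ2 (fun v => f v y)) (SC ρ1 ρ2 τ1 τ2 f') x := by
  rw [Vs_forall] at h
  obtain ⟨a, b, c, d, e⟩ := h
  exact (a.add ((b.sub c).const_mul _)).sub ((d.sub e).const_mul _)

lemma SC_continuousOn {ρ1 ρ2 τ1 τ2 : ℝ} {f : ℝ → ℝ → ℂ} {s : Set ℝ}
    (h : ∀ v ∈ Vs τ1 τ2, ContinuousOn (f v) s) :
    ContinuousOn (fun y => SC ρ1 ρ2 τ1 τ2 (fun v => f v y)) s := by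
  rw [Vs_forall] at h
  obtain ⟨a, b, c, d, e⟩ := h
  exact (a.add (continuousOn_const.mul (b.sub c))).sub (continuousOn_const.mul (d.sub e))

lemma SR_continuousOn {ρ1 ρ2 τ1 τ2 : ℝ} {f : ℝ → ℝ → ℝ} {s : Set ℝ}
    (h : ∀ v ∈ Vs τ1 τ2, ContinuousOn (f v) s) :
    ContinuousOn (fun y => SR ρ1 ρ2 τ1 τ2 (fun v => f v y)) s := by
  rw [Vs_forall] at h
  obtain ⟨a, b, c, d, e⟩ := h
  exact (a.add (continuousOn_const.mul (b.sub c))).sub (continuousOn_const.mul (d.sub e))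

section par
variable {c h ρ1 ρ2 τ1 τ2 : ℝ}

lemma Par.rho1 (H : Par c h ρ1 ρ2 τ1 τ2) : ρ1 ^ 2 = (1 - c) ^ 2 + h ^ 2 := by
  have := H.t1
  have h1 : 4 * τ1 ^ 2 * (ρ1 ^ 2 - ((1 - c) ^ 2 + h ^ 2)) = 0 := by
    linear_combination (-(h * (τ1 ^ 2 + 1)) - 2 * ρ1 * τ1) * H.f1 +
      ((h * (τ1 ^ 2 - 1)) + 2 * (1 - c) * τ1) * H.e1
  have h2 : ρ1 ^ 2 - ((1 - c) ^ 2 + h ^ 2) = 0 := by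
    rcases mul_eq_zero.1 h1 with h | h
    · exact absurd h (by positivity)
    · exact h
  linarith

lemma Par.rho2 (H : Par c h ρ1 ρ2 τ1 τ2) : ρ2 ^ 2 = (1 + c) ^ 2 + h ^ 2 := by
  have := H.t2
  have h1 : 4 * τ2 ^ 2 * (ρ2 ^ 2 - ((1 + c) ^ 2 + h ^ 2)) = 0 := by
    linear_combination (-(h * (τ2 ^ 2 + 1)) - 2 * ρ2 * τ2) * H.f2 +
      ((h * (τ2 ^ 2 - 1)) + 2 * (-1 - c) * τ2) * H.e2
  have h2 : ρ2 ^ 2 - ((1 + c) ^ 2 + h ^ 2) = 0 := by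
    rcases mul_eq_zero.1 h1 with h | h
    · exact absurd h (by positivity)
    · exact h
  linarith

/-- basic algebra of the uniformization -/
lemma p_basic (hh : (h : ℂ) ≠ 0) {z w p : ℂ} (hw : w ^ 2 = (z - c) ^ 2 + (h : ℂ) ^ 2)
    (hp : p = (z - c + w) / h) :
    p ≠ 0 ∧ 2 * p * (z - c) = h * (p ^ 2 - 1) ∧ 2 * p * w = h * (p ^ 2 + 1) := by
  have e : (h : ℂ) * p = z - c + w := by rw [hp]; field_simp
  refine ⟨?_, ?_, ?_⟩
  · rintro rfl
    have : (h : ℂ) ^ 2 = 0 := by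
      have h2 : w = -(z - c) := by linear_combination -e
      rw [h2] at hw; linear_combination -hw
    exact hh (by simpa using this)
  · apply mul_left_cancel₀ hh
    linear_combination (2 * (z - c) - (h * p + (z - c + w))) * e - hw
  · apply mul_left_cancel₀ hh
    linear_combination (2 * w - (h * p + (z - c + w))) * e + hw

lemma p_factor {z p x τ : ℂ} {h c : ℂ} (ht : τ ≠ 0)
    (hx : h * (τ ^ 2 - 1) = 2 * (x - c) * τ)
    (hp : 2 * p * (z - c) = h * (p ^ 2 - 1)) :
    h * ((p - τ) * (p - (-1 / τ))) = 2 * p * (z - x) := by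
  field_simp
  linear_combination -τ * hp - p * hx

lemma p_facts (H : Par c h ρ1 ρ2 τ1 τ2) {z w p : ℂ}
    (hw : w ^ 2 = (z - c) ^ 2 + (h : ℂ) ^ 2)
    (hp : p = (z - c + w) / h) (hz : z ≠ 1) (hz' : z ≠ -1) :
    (∀ v ∈ Vs τ1 τ2, p - (v : ℂ) ≠ 0) ∧
    SC ρ1 ρ2 τ1 τ2 (fun v => 1 / (p - v)) * (p * (z ^ 2 - 1)) = w ^ 2 := by
  have hh : (h : ℂ) ≠ 0 := by exact_mod_cast H.h0.ne'
  have ht1 : (τ1 : ℂ) ≠ 0 := by exact_mod_cast H.t1.ne'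
  have ht2 : (τ2 : ℂ) ≠ 0 := by exact_mod_cast H.t2.ne'
  obtain ⟨p0, a, b⟩ := p_basic hh hw hp
  have e1 : (h : ℂ) * ((τ1 : ℂ) ^ 2 - 1) = 2 * (1 - c) * τ1 := by exact_mod_cast H.e1
  have e2 : (h : ℂ) * ((τ2 : ℂ) ^ 2 - 1) = 2 * (-1 - c) * τ2 := by exact_mod_cast H.e2
  have f1 : (h : ℂ) * ((τ1 : ℂ) ^ 2 + 1) = 2 * ρ1 * τ1 := by exact_mod_cast H.f1
  have f2 : (h : ℂ) * ((τ2 : ℂ) ^ 2 + 1) = 2 * ρ2 * τ2 := by exact_mod_cast H.f2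
  have g1 := p_factor ht1 e1 a
  have g2 := p_factor ht2 e2 a
  have z1 : z - 1 ≠ 0 := sub_ne_zero.2 hz
  have z2 : z - (-1) ≠ 0 := sub_ne_zero.2 hz'
  have n1 : (h : ℂ) * ((p - τ1) * (p - (-1 / τ1))) ≠ 0 := by
    rw [g1]; simp [p0, z1]
  have n2 : (h : ℂ) * ((p - τ2) * (p - (-1 / τ2))) ≠ 0 := by
    rw [g2]; exact mul_ne_zero (by simp [p0]) z2
  have m1 := right_ne_zero_of_mul n1
  have m2 := right_ne_zero_of_mul n2
  have a1 := left_ne_zero_of_mul m1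
  have a2 := right_ne_zero_of_mul m1
  have a3 := left_ne_zero_of_mul m2
  have a4 := right_ne_zero_of_mul m2
  refine ⟨?_, ?_⟩
  · rw [Vs_forall]
    push_cast
    exact ⟨by simpa using p0, a1, a2, a3, a4⟩
  · have r1 : 1 / (p - τ1) - 1 / (p - (-1 / τ1)) = ρ1 / (p * (z - 1)) := by
      rw [div_sub_div _ _ a1 a2, div_eq_div_iff m1 (mul_ne_zero p0 z1)]
      apply mul_left_cancel₀ hh
      apply mul_left_cancel₀ ht1
      have : τ1 * (1 * (p - -1 / τ1) - (p - τ1) * 1) = (τ1:ℂ) ^ 2 + 1 := by field_simp; ring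
      linear_combination (h * (p * (z - 1))) * this - ρ1 * τ1 * g1 + p * (z - 1) * f1
    have r2 : 1 / (p - τ2) - 1 / (p - (-1 / τ2)) = ρ2 / (p * (z + 1)) := by
      rw [sub_neg_eq_add] at z2
      rw [div_sub_div _ _ a3 a4, div_eq_div_iff m2 (mul_ne_zero p0 z2)]
      apply mul_left_cancel₀ hh
      apply mul_left_cancel₀ ht2
      have : τ2 * (1 * (p - -1 / τ2) - (p - τ2) * 1) = (τ2:ℂ) ^ 2 + 1 := by field_simp; ring
      linear_combination (h * (p * (z + 1))) * this - ρ2 * τ2 * g2 + p * (z + 1) * f2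
    have q1 : (ρ1 : ℂ) ^ 2 = (1 - c) ^ 2 + (h : ℂ) ^ 2 := by exact_mod_cast H.rho1
    have q2 : (ρ2 : ℂ) ^ 2 = (1 + c) ^ 2 + (h : ℂ) ^ 2 := by exact_mod_cast H.rho2
    rw [sub_neg_eq_add] at z2
    simp only [SC]
    push_cast
    rw [r1, r2, sub_zero, show z ^ 2 - 1 = (z - 1) * (z + 1) by ring]
    field_simp
    linear_combination (z + 1) * q1 - (z - 1) * q2 - 2 * hw

/-- derivative of a continuous square root along a curve -/
lemma sqrt_deriv {γ g : ℝ → ℂ} {γ' : ℂ} {t : ℝ} {c h : ℂ} (hγ : HasDerivAt γ γ' t)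
    (hg : ContinuousAt g t) (he : ∀ᶠ s in 𝓝 t, g s ^ 2 = (γ s - c) ^ 2 + h ^ 2)
    (h0 : g t ≠ 0) : HasDerivAt g ((γ t - c) * γ' / g t) t := by
  have h1 : HasDerivAt (fun s => (γ s - c) ^ 2 + h ^ 2) (2 * (γ t - c) * γ') t := by
    have := ((hγ.sub_const c).fun_pow 2).add_const (h ^ 2)
    refine this.congr_deriv ?_
    norm_num
  rw [hasDerivAt_iff_tendsto_slope] at h1 ⊢
  have h2 : Tendsto (fun s => g s + g t) (𝓝[≠] t) (𝓝 (g t + g t)) :=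
    (hg.tendsto.mono_left nhdsWithin_le_nhds).add_const _
  have h3 : g t + g t ≠ 0 := by rw [← two_mul]; simp [h0]
  have h4 := h1.div h2 h3
  have e : 2 * (γ t - c) * γ' / (g t + g t) = (γ t - c) * γ' / g t := by
    field_simp; ring
  rw [e] at h4
  refine h4.congr' ?_
  have h5 : ∀ᶠ s in 𝓝[≠] t, g s + g t ≠ 0 := h2.eventually_ne h3
  filter_upwards [h5, nhdsWithin_le_nhds he] with s hs hs'
  simp only [Pi.div_apply, slope_def_module]
  rw [← hs', ← he.self_of_nhds]
  rw [div_eq_iff hs, smul_mul_assoc]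
  congr 1
  ring

lemma p_deriv {γ g : ℝ → ℂ} {γ' : ℂ} {t : ℝ} {c h : ℂ} (hγ : HasDerivAt γ γ' t)
    (hg : ContinuousAt g t) (he : ∀ᶠ s in 𝓝 t, g s ^ 2 = (γ s - c) ^ 2 + h ^ 2)
    (h0 : g t ≠ 0) :
    HasDerivAt (fun s => (γ s - c + g s) / h) ((γ t - c + g t) / h * γ' / g t) t := by
  have := ((hγ.sub_const c).add (sqrt_deriv hγ hg he h0)).div_const h
  refine this.congr_deriv ?_
  field_simp
  ring

end par

section par2
variable {c h ρ1 ρ2 τ1 τ2 : ℝ}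

lemma integrand_continuousOn {γ g : ℝ → ℂ} (hγ : ContDiff ℝ 1 γ)
    (hg : ContinuousOn g (Icc 0 1)) (h1 : ∀ t ∈ Icc (0:ℝ) 1, γ t ≠ 1 ∧ γ t ≠ -1) :
    ContinuousOn (fun t => g t / ((γ t) ^ 2 - 1) * deriv γ t) (Icc 0 1) := by
  refine (hg.div ?_ ?_).mul (hγ.continuous_deriv le_rfl).continuousOn
  · exact (((hγ.continuous).pow 2).sub continuous_const).continuousOn
  · intro t ht h
    obtain ⟨a, b⟩ := h1 t ht
    have : (γ t - 1) * (γ t + 1) = 0 := by linear_combination h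
    rcases mul_eq_zero.1 this with h | h
    · exact a (sub_eq_zero.1 h)
    · exact b (eq_neg_of_add_eq_zero_left h)

lemma p_continuousOn {γ g : ℝ → ℂ} (hγ : ContDiff ℝ 1 γ)
    (hg : ContinuousOn g (Icc 0 1)) :
    ContinuousOn (fun t => (γ t - c + g t) / (h:ℂ)) (Icc 0 1) :=
  ((hγ.continuous.continuousOn.sub continuousOn_const).add hg).div_const _

lemma sq_sub_one_ne {z : ℂ} (h : z ≠ 1 ∧ z ≠ -1) : z ^ 2 - 1 ≠ 0 := by
  intro h'
  have : (z - 1) * (z + 1) = 0 := by linear_combination h'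
  rcases mul_eq_zero.1 this with h1 | h1
  · exact h.1 (sub_eq_zero.1 h1)
  · exact h.2 (eq_neg_of_add_eq_zero_left h1)

/-- Fundamental theorem of calculus along a curve, with explicit logarithms. -/
lemma curve_integral (H : Par c h ρ1 ρ2 τ1 τ2) {γ g : ℝ → ℂ} (hγ : ContDiff ℝ 1 γ)
    (hg : ContinuousOn g (Icc 0 1))
    (hsq : ∀ t ∈ Icc (0:ℝ) 1, g t ^ 2 = (γ t - c) ^ 2 + (h:ℂ) ^ 2)
    (h1 : ∀ t ∈ Icc (0:ℝ) 1, γ t ≠ 1 ∧ γ t ≠ -1)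
    (h0 : ∀ t ∈ Ioo (0:ℝ) 1, g t ≠ 0) (ε : ℝ → ℂ)
    (hε : ∀ v ∈ Vs τ1 τ2, ∀ t ∈ Icc (0:ℝ) 1,
      ε v * ((γ t - c + g t) / h - v) ∈ slitPlane) :
    (∫ t in (0:ℝ)..1, g t / ((γ t) ^ 2 - 1) * deriv γ t) =
      SC ρ1 ρ2 τ1 τ2 (fun v => Complex.log (ε v * ((γ 1 - c + g 1) / h - v))) -
      SC ρ1 ρ2 τ1 τ2 (fun v => Complex.log (ε v * ((γ 0 - c + g 0) / h - v))) := by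
  have hh : (h : ℂ) ≠ 0 := by exact_mod_cast H.h0.ne'
  have hp := p_continuousOn (c := c) (h := h) hγ hg
  refine intervalIntegral.integral_eq_sub_of_hasDerivAt_of_le
    (f := fun t => SC ρ1 ρ2 τ1 τ2 (fun v => Complex.log (ε v * ((γ t - c + g t) / h - v))))
    zero_le_one ?_ ?_ ?_
  · apply SC_continuousOn
    intro v hv
    exact (continuousOn_const.mul (hp.sub continuousOn_const)).clog (hε v hv)
  · intro t ht
    have ht' := Ioo_subset_Icc_self ht
    have hn : Icc (0:ℝ) 1 ∈ 𝓝 t := Icc_mem_nhds ht.1 ht.2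
    have hd := p_deriv (h := (h:ℂ)) (c := (c:ℂ)) ((hγ.differentiable one_ne_zero).differentiableAt (x := t)).hasDerivAt
      (hg.continuousAt hn) (by filter_upwards [hn] with s hs using hsq s hs) (h0 t ht)
    obtain ⟨n1, n2⟩ := p_facts H (hsq t ht') rfl (h1 t ht').1 (h1 t ht').2
    obtain ⟨p0, -, -⟩ := p_basic hh (hsq t ht') rfl
    have := SC_hasDerivAt (ρ1 := ρ1) (ρ2 := ρ2) (τ1 := τ1) (τ2 := τ2)
      (f := fun v t => Complex.log (ε v * ((γ t - c + g t) / h - v)))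
      (f' := fun v => 1 / ((γ t - c + g t) / h - v) *
          ((γ t - c + g t) / h * deriv γ t / g t)) (x := t) (by
        intro v hv
        refine (((hd.sub_const (v:ℂ)).const_mul (ε v)).clog_real (hε v hv t ht')).congr_deriv ?_
        have a := slitPlane_ne_zero (hε v hv t ht')
        have a1 := left_ne_zero_of_mul a
        have a2 := n1 v hv
        rw [mul_div_mul_left _ _ a1]
        ring)
    refine this.congr_deriv ?_
    rw [SC_mul]
    generalize SC ρ1 ρ2 τ1 τ2 (fun v => 1 / ((γ t - c + g t) / h - v)) = X at n2
    generalize (γ t - c + g t) / (h:ℂ) = p at n2 p0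
    have g0 := h0 t ht
    have z0 := sq_sub_one_ne (h1 t ht')
    have : X = g t ^ 2 / (p * (γ t ^ 2 - 1)) := by
      rw [eq_div_iff (mul_ne_zero p0 z0)]; exact n2
    rw [this]
    field_simp
  · apply ContinuousOn.intervalIntegrable
    rw [uIcc_of_le zero_le_one]
    exact integrand_continuousOn hγ hg h1

/-- local primitive in the uniformizing variable -/
def Floc (ρ1 ρ2 τ1 τ2 : ℝ) (p0 p : ℂ) : ℂ :=
  SC ρ1 ρ2 τ1 τ2 (fun v => Complex.log ((p - v) / (p0 - v)))

lemma Floc_self {p0 : ℂ} (h0 : ∀ v ∈ Vs τ1 τ2, p0 - (v : ℂ) ≠ 0) :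
    Floc ρ1 ρ2 τ1 τ2 p0 p0 = 0 := by
  unfold Floc
  rw [SC_congr (g := fun _ => 0)]
  · simp [SC]
  · intro v hv
    rw [div_self (h0 v hv), Complex.log_one]

lemma Floc_hasDerivAt {p0 : ℂ} (h0 : ∀ v ∈ Vs τ1 τ2, p0 - (v : ℂ) ≠ 0) :
    ∀ᶠ p in 𝓝 p0, HasDerivAt (Floc ρ1 ρ2 τ1 τ2 p0)
      (SC ρ1 ρ2 τ1 τ2 (fun v => 1 / (p - v))) p := by
  have key : ∀ v ∈ Vs τ1 τ2, ∀ᶠ p in 𝓝 p0, (p - v) / (p0 - v) ∈ slitPlane := by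
    intro v hv
    have : ContinuousAt (fun p : ℂ => (p - v) / (p0 - v)) p0 := by fun_prop
    apply this.eventually_mem
    apply isOpen_slitPlane.mem_nhds
    rw [div_self (h0 v hv)]
    exact one_mem_slitPlane
  have key2 : ∀ᶠ p in 𝓝 p0, ∀ v ∈ Vs τ1 τ2, (p - v) / (p0 - v) ∈ slitPlane := by
    rw [Vs_forall] at key
    obtain ⟨a, b, c, d, e⟩ := key
    filter_upwards [a, b, c, d, e] with p a b c d e
    rw [Vs_forall]
    exact ⟨a, b, c, d, e⟩
  filter_upwards [key2] with p hp
  unfold Floc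
  apply SC_hasDerivAt
  intro v hv
  have := (((hasDerivAt_id p).sub_const (v:ℂ)).div_const (p0 - v)).clog (hp v hv)
  refine this.congr_deriv ?_
  simp only [id]
  have a := slitPlane_ne_zero (hp v hv)
  have b := h0 v hv
  rw [div_div_div_cancel_right₀ b]

lemma Floc_re {p0 p : ℂ} (h0 : ∀ v ∈ Vs τ1 τ2, p0 - (v : ℂ) ≠ 0)
    (h1 : ∀ v ∈ Vs τ1 τ2, p - (v : ℂ) ≠ 0) :
    (Floc ρ1 ρ2 τ1 τ2 p0 p).re = SR ρ1 ρ2 τ1 τ2 (fun v => Real.log ‖p - v‖) -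
      SR ρ1 ρ2 τ1 τ2 (fun v => Real.log ‖p0 - v‖) := by
  unfold Floc
  rw [SC_re, ← SR_sub]
  apply SR_congr
  intro v hv
  rw [Complex.log_re, norm_div, Real.log_div (by simpa using h1 v hv) (by simpa using h0 v hv)]

lemma Floc_branch (H : Par c h ρ1 ρ2 τ1 τ2) {z0 p0 : ℂ}
    (hw : (0:ℂ) ^ 2 = (z0 - c) ^ 2 + (h : ℂ) ^ 2)
    (hp : p0 = (z0 - c + 0) / h) (hz : z0 ≠ 1) (hz' : z0 ≠ -1) :
    Floc ρ1 ρ2 τ1 τ2 p0 =O[𝓝 p0] (fun p => (p - p0) ^ 3) := by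
  have hh : (h : ℂ) ≠ 0 := by exact_mod_cast H.h0.ne'
  obtain ⟨n0, a0, b0⟩ := p_basic hh hw hp
  obtain ⟨m0, -⟩ := p_facts H hw hp hz hz'
  have hp2 : p0 ^ 2 + 1 = 0 := by
    have : (h:ℂ) * (p0 ^ 2 + 1) = 0 := by rw [← b0]; ring
    exact (mul_eq_zero.1 this).resolve_left hh
  -- the inverse map
  set Z : ℂ → ℂ := fun p => c + h / 2 * (p - 1 / p) with hZ
  have hZ0 : Z p0 = z0 := by
    simp only [hZ]
    have : 2 * p0 * (c + h / 2 * (p0 - 1 / p0)) = 2 * p0 * z0 := by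
      field_simp
      linear_combination -a0
    exact mul_left_cancel₀ (by simpa using n0) this
  have cZ : ContinuousAt Z p0 := by
    simp only [hZ]
    refine continuousAt_const.add (continuousAt_const.mul (continuousAt_id.sub ?_))
    exact continuousAt_const.div continuousAt_id n0
  set k : ℂ → ℂ := fun p => (h / 2 * (p + p0) / p) ^ 2 / (p * (Z p ^ 2 - 1)) with hk
  have ck : ContinuousAt k p0 := by
    simp only [hk]
    refine ContinuousAt.div ?_ ?_ ?_
    · exact ((continuousAt_const.mul (continuousAt_id.add continuousAt_const)).div
        continuousAt_id n0).pow 2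
    · exact continuousAt_id.mul ((cZ.pow 2).sub continuousAt_const)
    · rw [hZ0]; exact mul_ne_zero n0 (sq_sub_one_ne ⟨hz, hz'⟩)
  have hD : ∀ᶠ p in 𝓝 p0, SC ρ1 ρ2 τ1 τ2 (fun v => 1 / (p - v)) = (p - p0) ^ 2 * k p := by
    have e1 : ∀ᶠ p in 𝓝 p0, Z p ≠ 1 := cZ.eventually_ne (by rw [hZ0]; exact hz)
    have e2 : ∀ᶠ p in 𝓝 p0, Z p ≠ -1 := cZ.eventually_ne (by rw [hZ0]; exact hz')
    have e3 : ∀ᶠ p in 𝓝 p0, p ≠ 0 := continuousAt_id.eventually_ne n0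
    filter_upwards [e1, e2, e3] with p q1 q2 q3
    have := (p_facts H (z := Z p) (w := h / 2 * (p + 1 / p)) (p := p) (by
      simp only [hZ]; field_simp; ring) (by simp only [hZ]; field_simp; ring) q1 q2).2
    have zz := sq_sub_one_ne ⟨q1, q2⟩
    rw [← eq_div_iff (mul_ne_zero q3 zz)] at this
    rw [this]
    simp only [hk]
    rw [← mul_div_assoc, ← mul_pow]
    congr 2
    field_simp
    linear_combination hp2
  obtain ⟨C, hC⟩ : ∃ C, ∀ᶠ p in 𝓝 p0, ‖k p‖ ≤ C := by
    refine ⟨‖k p0‖ + 1, ?_⟩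
    exact (ck.norm.eventually_lt_const (by linarith : ‖k p0‖ < ‖k p0‖ + 1)).mono fun _ h => h.le
  have hall := (Floc_hasDerivAt (ρ1 := ρ1) (ρ2 := ρ2) m0).and (hD.and hC)
  obtain ⟨δ, hδ, hball⟩ := Metric.eventually_nhds_iff_ball.1 hall
  refine Asymptotics.IsBigO.of_bound C ?_
  filter_upwards [Metric.ball_mem_nhds p0 hδ] with p hpb
  have hsub : ∀ q ∈ Metric.closedBall p0 (dist p p0), q ∈ Metric.ball p0 δ := by
    intro q hq
    exact lt_of_le_of_lt (Metric.mem_closedBall.1 hq) hpb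
  have hC0 : 0 ≤ C := (norm_nonneg _).trans (hball p0 (Metric.mem_ball_self hδ)).2.2
  have := (convex_closedBall p0 (dist p p0)).norm_image_sub_le_of_norm_hasDerivWithin_le
    (f := Floc ρ1 ρ2 τ1 τ2 p0) (f' := fun p => SC ρ1 ρ2 τ1 τ2 (fun v => 1 / (p - v)))
    (C := C * dist p p0 ^ 2) (x := p0) (y := p)
    (fun q hq => (hball q (hsub q hq)).1.hasDerivWithinAt)
    (fun q hq => by
      rw [(hball q (hsub q hq)).2.1, norm_mul, norm_pow, mul_comm, ← dist_eq_norm]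
      have := Metric.mem_closedBall.1 hq
      have h3 := (hball q (hsub q hq)).2.2
      gcongr)
    (Metric.mem_closedBall_self dist_nonneg) (Metric.mem_closedBall.2 le_rfl)
  rw [Floc_self m0, sub_zero, dist_eq_norm] at this
  rw [norm_pow]
  linarith

lemma Floc_curve_deriv (H : Par c h ρ1 ρ2 τ1 τ2) {γ g : ℝ → ℂ} {γ' : ℂ} {t : ℝ}
    (hγ : HasDerivAt γ γ' t)
    (hg : ContinuousAt g t)
    (hsq : ∀ᶠ s in 𝓝 t, g s ^ 2 = (γ s - c) ^ 2 + (h:ℂ) ^ 2)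
    (h1 : γ t ≠ 1 ∧ γ t ≠ -1) :
    HasDerivAt (fun s => Floc ρ1 ρ2 τ1 τ2 ((γ t - c + g t) / h) ((γ s - c + g s) / h))
      (g t / ((γ t) ^ 2 - 1) * γ') t := by
  have hh : (h : ℂ) ≠ 0 := by exact_mod_cast H.h0.ne'
  have hs0 := hsq.self_of_nhds
  obtain ⟨n1, n2⟩ := p_facts H hs0 rfl h1.1 h1.2
  obtain ⟨p0, pa, pb⟩ := p_basic hh hs0 rfl
  have hpc : ContinuousAt (fun s => (γ s - c + g s) / (h:ℂ)) t :=
    ((hγ.continuousAt.sub continuousAt_const).add hg).div_const _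
  by_cases g0 : g t = 0
  · have hb := Floc_branch H (z0 := γ t) (p0 := (γ t - c + g t) / h)
      (by rw [← hs0, g0]) (by rw [g0]) h1.1 h1.2
    rw [g0, zero_div, zero_mul, hasDerivAt_iff_isLittleO]
    have hb2 := hb.comp_tendsto hpc.tendsto
    simp only [smul_zero, sub_zero]
    rw [← g0, Floc_self n1]
    simp only [sub_zero]
    refine hb2.trans_isLittleO ?_
    have e2 : (fun s => (((γ s - c + g s) / (h:ℂ)) - ((γ t - c + g t) / h)) ^ 2) =O[𝓝 t]
        (fun s => s - t) := by
      have e3 : (fun s => (((γ s - c + g s) / (h:ℂ)) - ((γ t - c + g t) / h)) ^ 2) =ᶠ[𝓝 t]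
          (fun s => (2 / h * ((γ s - c + g s) / (h:ℂ))) * (γ s - γ t)) := by
        filter_upwards [hsq] with s hs
        obtain ⟨-, a, b⟩ := p_basic hh hs rfl
        set p := (γ s - c + g s) / (h:ℂ)
        have hq : h * ((γ t - c + g t) / h) = γ t - c := by rw [g0]; field_simp; ring
        set q := (γ t - c + g t) / (h:ℂ)
        have hq2 : q ^ 2 + 1 = 0 := by
          have : (h:ℂ) * (q ^ 2 + 1) = 0 := by rw [← pb, g0]; ring
          exact (mul_eq_zero.1 this).resolve_left hh
        apply mul_left_cancel₀ hh
        field_simp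
        linear_combination -a - 2 * p * hq + h * hq2
      refine e3.trans_isBigO ?_
      have o1 : (fun s => (2 / h * ((γ s - c + g s) / (h:ℂ)))) =O[𝓝 t] (fun _ => (1:ℝ)) :=
        (hpc.const_mul _ : ContinuousAt (fun s => 2 / (h:ℂ) * ((γ s - c + g s) / (h:ℂ))) t).isBigO_one ℝ
      have o2 := hγ.isBigO_sub
      simpa using o1.mul o2
    have e4 : (fun s => (((γ s - c + g s) / (h:ℂ)) - ((γ t - c + g t) / h))) =o[𝓝 t]
        (fun _ => (1:ℝ)) := by
      rw [Asymptotics.isLittleO_one_iff]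
      have := hpc.tendsto.sub_const ((γ t - c + g t) / (h:ℂ))
      simpa using this
    have := e2.mul_isLittleO e4
    simpa [pow_succ, Function.comp_def] using this
  · have hd := p_deriv (h := (h:ℂ)) (c := (c:ℂ)) hγ hg hsq g0
    have hF := (Floc_hasDerivAt (ρ1 := ρ1) (ρ2 := ρ2) n1).self_of_nhds
    refine (hF.comp_of_eq t hd rfl).congr_deriv ?_
    generalize SC ρ1 ρ2 τ1 τ2 (fun v => 1 / ((γ t - c + g t) / h - v)) = X at n2
    generalize (γ t - c + g t) / (h:ℂ) = p at n2 p0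
    have z0 := sq_sub_one_ne h1
    have : X = g t ^ 2 / (p * (γ t ^ 2 - 1)) := by
      rw [eq_div_iff (mul_ne_zero p0 z0)]; exact n2
    rw [this]
    field_simp

/-- The real part of the integral, globally. -/
lemma re_integral (H : Par c h ρ1 ρ2 τ1 τ2) {γ g : ℝ → ℂ} (hγ : ContDiff ℝ 1 γ)
    (hg : ContinuousOn g (Icc 0 1))
    (hsq : ∀ t ∈ Icc (0:ℝ) 1, g t ^ 2 = (γ t - c) ^ 2 + (h:ℂ) ^ 2)
    (h1 : ∀ t ∈ Icc (0:ℝ) 1, γ t ≠ 1 ∧ γ t ≠ -1) :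
    (∫ t in (0:ℝ)..1, g t / ((γ t) ^ 2 - 1) * deriv γ t).re =
      SR ρ1 ρ2 τ1 τ2 (fun v => Real.log ‖((γ 1 - c + g 1) / h - v : ℂ)‖) -
      SR ρ1 ρ2 τ1 τ2 (fun v => Real.log ‖((γ 0 - c + g 0) / h - v : ℂ)‖) := by
  have hp := p_continuousOn (c := c) (h := h) hγ hg
  have hI : IntervalIntegrable (fun t => g t / ((γ t) ^ 2 - 1) * deriv γ t) MeasureTheory.volume 0 1 := by
    apply ContinuousOn.intervalIntegrable
    rw [uIcc_of_le zero_le_one]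
    exact integrand_continuousOn hγ hg h1
  have := Complex.reCLM.intervalIntegral_comp_comm hI
  simp only [Complex.reCLM_apply] at this
  rw [← this]
  have hne : ∀ t ∈ Icc (0:ℝ) 1, ∀ v ∈ Vs τ1 τ2, (γ t - c + g t) / (h:ℂ) - v ≠ 0 :=
    fun t ht => (p_facts H (hsq t ht) rfl (h1 t ht).1 (h1 t ht).2).1
  refine intervalIntegral.integral_eq_sub_of_hasDerivAt_of_le
    (f := fun t => SR ρ1 ρ2 τ1 τ2 (fun v => Real.log ‖((γ t - c + g t) / h - v : ℂ)‖))
    zero_le_one ?_ ?_ ?_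
  · apply SR_continuousOn
    intro v hv
    refine ((hp.sub continuousOn_const).norm).log ?_
    intro t ht
    simpa using hne t ht v hv
  · intro t ht
    have ht' := Ioo_subset_Icc_self ht
    have hn : Icc (0:ℝ) 1 ∈ 𝓝 t := Icc_mem_nhds ht.1 ht.2
    have hd := Floc_curve_deriv H ((hγ.differentiable one_ne_zero).differentiableAt (x := t)).hasDerivAt
      (hg.continuousAt hn) (by filter_upwards [hn] with s hs using hsq s hs) (h1 t ht')
    have hr := (Complex.reCLM.hasFDerivAt.comp_hasDerivAt t hd).add_const
      (SR ρ1 ρ2 τ1 τ2 (fun v => Real.log ‖((γ t - c + g t) / h - v : ℂ)‖))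
    refine hr.congr_of_eventuallyEq ?_
    filter_upwards [hn] with s hs
    simp only [Function.comp_apply, Complex.reCLM_apply]
    rw [Floc_re (hne t ht') (hne s hs)]
    ring
  · apply ContinuousOn.intervalIntegrable
    rw [uIcc_of_le zero_le_one]
    exact Complex.continuous_re.comp_continuousOn (integrand_continuousOn hγ hg h1)

end par2

section par3
variable {c h ρ1 ρ2 τ1 τ2 : ℝ}

def Lev (c h ρ1 ρ2 τ1 τ2 : ℝ) (G : Set ℂ) : Prop :=
  ∀ z ∈ G, (z ≠ 1 ∧ z ≠ -1) ∧ ∀ w : ℂ, w ^ 2 = (z - c) ^ 2 + (h : ℂ) ^ 2 →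
    SR ρ1 ρ2 τ1 τ2 (fun v => Real.log ‖((z - c + w) / h - v : ℂ)‖) =
      ρ1 / 2 * Real.log τ1 - ρ2 / 2 * Real.log τ2

lemma log_neg_inv {p : ℂ} {τ : ℝ} (ht : 0 < τ) (p0 : p ≠ 0) (a : p - (τ:ℂ) ≠ 0)
    (b : p - ((-1 / τ : ℝ):ℂ) ≠ 0) :
    Real.log ‖-1 / p - (τ:ℂ)‖ - Real.log ‖-1 / p - ((-1 / τ : ℝ):ℂ)‖ =
      2 * Real.log τ - (Real.log ‖p - (τ:ℂ)‖ - Real.log ‖p - ((-1 / τ : ℝ):ℂ)‖) := by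
  have ht' : (τ:ℂ) ≠ 0 := by exact_mod_cast ht.ne'
  have e1 : -1 / p - (τ:ℂ) = -(τ * (p - ((-1 / τ : ℝ):ℂ)) / p) := by
    push_cast; field_simp; ring
  have e2 : -1 / p - ((-1 / τ : ℝ):ℂ) = (p - τ) / (τ * p) := by
    push_cast; field_simp; ring
  have n0 : ‖p‖ ≠ 0 := by simpa using p0
  have na : ‖p - (τ:ℂ)‖ ≠ 0 := by simpa using a
  have nb : ‖p - ((-1 / τ : ℝ):ℂ)‖ ≠ 0 := norm_ne_zero_iff.2 b
  rw [e1, e2, norm_neg, norm_div, norm_div, norm_mul, norm_mul, Complex.norm_real,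
    Real.norm_of_nonneg ht.le, Real.log_div (mul_ne_zero ht.ne' nb) n0,
    Real.log_div na (mul_ne_zero ht.ne' n0), Real.log_mul ht.ne' nb, Real.log_mul ht.ne' n0]
  ring

lemma SR_neg_inv (H : Par c h ρ1 ρ2 τ1 τ2) {p : ℂ} (h0 : ∀ v ∈ Vs τ1 τ2, p - (v:ℂ) ≠ 0) :
    SR ρ1 ρ2 τ1 τ2 (fun v => Real.log ‖-1 / p - (v : ℂ)‖) =
      2 * (ρ1 / 2 * Real.log τ1 - ρ2 / 2 * Real.log τ2) -
      SR ρ1 ρ2 τ1 τ2 (fun v => Real.log ‖p - (v : ℂ)‖) := by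
  rw [Vs_forall] at h0
  obtain ⟨a0, a1, a2, a3, a4⟩ := h0
  have p0 : p ≠ 0 := by simpa using a0
  simp only [SR]
  rw [log_neg_inv H.t1 p0 a1 a2, log_neg_inv H.t2 p0 a3 a4]
  have : Real.log ‖-1 / p - ((0:ℝ):ℂ)‖ = - Real.log ‖p - ((0:ℝ):ℂ)‖ := by
    simp
  rw [this]
  ring

lemma neg_w {z w : ℂ} (H : Par c h ρ1 ρ2 τ1 τ2) (hw : w ^ 2 = (z - c) ^ 2 + (h : ℂ) ^ 2) :
    (z - c + -w) / h = -1 / ((z - c + w) / h) := by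
  have hh : (h : ℂ) ≠ 0 := by exact_mod_cast H.h0.ne'
  obtain ⟨p0, -, -⟩ := p_basic hh hw rfl
  rw [eq_div_iff p0]
  field_simp
  linear_combination -hw

lemma SR_flip (H : Par c h ρ1 ρ2 τ1 τ2) {z w : ℂ} (hw : w ^ 2 = (z - c) ^ 2 + (h : ℂ) ^ 2)
    (hz : z ≠ 1 ∧ z ≠ -1) :
    SR ρ1 ρ2 τ1 τ2 (fun v => Real.log ‖((z - c + -w) / h - v : ℂ)‖) =
      2 * (ρ1 / 2 * Real.log τ1 - ρ2 / 2 * Real.log τ2) -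
      SR ρ1 ρ2 τ1 τ2 (fun v => Real.log ‖((z - c + w) / h - v : ℂ)‖) := by
  rw [neg_w H hw]
  exact SR_neg_inv H (p_facts H hw rfl hz.1 hz.2).1

lemma lev_gamma (H : Par c h ρ1 ρ2 τ1 τ2) (A B : ℝ) (hP : zetaP A B = c + h * I)
    (hM : zetaM A B = c - h * I) : Lev c h ρ1 ρ2 τ1 τ2 (GammaSet A B) := by
  rintro z ⟨γ, g, hγ, g0, g1, hne, hg, hsq, hre⟩
  have hsq' : ∀ t ∈ Icc (0:ℝ) 1, g t ^ 2 = (γ t - c) ^ 2 + (h:ℂ) ^ 2 := by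
    intro t ht
    rw [hsq t ht, hP, hM]
    linear_combination (-(h:ℂ) ^ 2) * Complex.I_sq
  have m0 : (0:ℝ) ∈ Icc (0:ℝ) 1 := by simp
  have m1 : (1:ℝ) ∈ Icc (0:ℝ) 1 := by simp
  have hz : z ≠ 1 ∧ z ≠ -1 := g1 ▸ hne 1 m1
  refine ⟨hz, ?_⟩
  have R := re_integral H hγ hg hsq' hne
  rw [hre] at R
  have gz : g 0 = 0 := by
    have := hsq 0 m0
    rw [g0] at this
    simpa using this
  have e0 := SR_flip H (hsq' 0 m0) (hne 0 m0)
  rw [gz] at e0 R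
  rw [neg_zero] at e0
  have key : SR ρ1 ρ2 τ1 τ2 (fun v => Real.log ‖((z - c + g 1) / h - v : ℂ)‖) =
      ρ1 / 2 * Real.log τ1 - ρ2 / 2 * Real.log τ2 := by
    rw [g1] at R
    linarith
  intro w hw
  have hw1 := hsq' 1 m1
  rw [g1] at hw1
  rcases sq_eq_sq_iff_eq_or_eq_neg.1 (hw.trans hw1.symm) with h | h
  · rw [h]; exact key
  · rw [h, SR_flip H hw1 hz, key]; ring

lemma chart (H : Par c h ρ1 ρ2 τ1 τ2) {G : Set ℂ} (hG : Lev c h ρ1 ρ2 τ1 τ2 G) {z0 w0 : ℂ}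
    (hz0 : z0 ∈ G) (hw0 : w0 ^ 2 = (z0 - c) ^ 2 + (h : ℂ) ^ 2) (w00 : w0 ≠ 0) :
    ∃ Φ : ℂ → ℂ, HasStrictDerivAt Φ (w0 / (z0 ^ 2 - 1)) z0 ∧
      ∀ᶠ z in 𝓝 z0, z ∈ G → (Φ z).re = 0 := by
  have hh : (h : ℂ) ≠ 0 := by exact_mod_cast H.h0.ne'
  obtain ⟨hz, hz2⟩ := hG z0 hz0
  obtain ⟨n1, n2⟩ := p_facts H hw0 rfl hz.1 hz.2
  obtain ⟨p0, -, -⟩ := p_basic hh hw0 rfl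
  set Q : ℂ → ℂ := fun z => (z - c) ^ 2 + (h : ℂ) ^ 2 with hQ
  have hQ0 : Q z0 = w0 ^ 2 := hw0.symm
  have hQ00 : Q z0 ≠ 0 := by rw [hQ0]; exact pow_ne_zero _ w00
  set W : ℂ → ℂ := fun z => w0 * Complex.exp (Complex.log (Q z / w0 ^ 2) / 2) with hW
  have hW0 : W z0 = w0 := by simp [hW, hQ0, w00]
  have hQa : AnalyticAt ℂ (fun z => Q z / w0 ^ 2) z0 := by
    simp only [hQ]; fun_prop (disch := exact pow_ne_zero _ w00)
  have hsl : Q z0 / w0 ^ 2 ∈ slitPlane := by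
    rw [hQ0, div_self (pow_ne_zero _ w00)]; exact one_mem_slitPlane
  have hWa : AnalyticAt ℂ W z0 := by
    have := (hQa.clog hsl)
    simp only [hW]
    exact analyticAt_const.mul ((this.div_const).cexp)
  have hWd : HasDerivAt W ((z0 - c) / w0) z0 := by
    have hQd : HasDerivAt (fun z => Q z / w0 ^ 2) (2 * (z0 - c) / w0 ^ 2) z0 := by
      have := ((((hasDerivAt_id z0).sub_const (c:ℂ)).fun_pow 2).add_const ((h:ℂ) ^ 2)).div_const (w0 ^ 2)
      refine this.congr_deriv ?_
      simp
    have := (((hQd.clog hsl).div_const 2).cexp).const_mul w0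
    refine this.congr_deriv ?_
    rw [hQ0, div_self (pow_ne_zero _ w00)]
    simp
    field_simp
  have hWsq : ∀ᶠ z in 𝓝 z0, W z ^ 2 = Q z := by
    have : ∀ᶠ z in 𝓝 z0, Q z / w0 ^ 2 ≠ 0 :=
      hQa.continuousAt.eventually_ne (slitPlane_ne_zero hsl)
    filter_upwards [this] with z hz
    simp only [hW]
    rw [mul_pow, ← Complex.exp_nat_mul, Nat.cast_ofNat, mul_div_cancel₀ _ (two_ne_zero),
      Complex.exp_log hz]
    field_simp
  set P : ℂ → ℂ := fun z => (z - c + W z) / h with hP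
  have hPd : HasDerivAt P ((1 + (z0 - c) / w0) / h) z0 :=
    (((hasDerivAt_id z0).sub_const (c:ℂ)).add hWd).div_const _
  have hPa : AnalyticAt ℂ P z0 := by
    simp only [hP]
    exact ((analyticAt_id.sub analyticAt_const).add hWa).div_const
  have hP0 : P z0 = (z0 - c + w0) / h := by simp only [hP, hW0]
  have hFa : AnalyticAt ℂ (Floc ρ1 ρ2 τ1 τ2 ((z0 - c + w0) / h)) ((z0 - c + w0) / h) := by
    rw [Complex.analyticAt_iff_eventually_differentiableAt]
    filter_upwards [Floc_hasDerivAt (ρ1 := ρ1) (ρ2 := ρ2) n1] with p hp using hp.differentiableAt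
  have hFd := (Floc_hasDerivAt (ρ1 := ρ1) (ρ2 := ρ2) n1).self_of_nhds
  refine ⟨fun z => Floc ρ1 ρ2 τ1 τ2 ((z0 - c + w0) / h) (P z), ?_, ?_⟩
  · have ha : AnalyticAt ℂ (fun z => Floc ρ1 ρ2 τ1 τ2 ((z0 - c + w0) / h) (P z)) z0 :=
      hFa.comp_of_eq hPa hP0
    have hd := hFd.comp_of_eq z0 hPd hP0.symm
    have hs := ha.hasStrictDerivAt
    have e := hd.deriv
    have e' : deriv (fun z => Floc ρ1 ρ2 τ1 τ2 ((z0 - c + w0) / h) (P z)) z0 = w0 / (z0 ^ 2 - 1) := by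
      refine Eq.trans e ?_
      have z00 := sq_sub_one_ne hz
      have n3 := n2
      have hq : (1 + (z0 - c) / w0) / (h:ℂ) = (z0 - c + w0) / h / w0 := by field_simp; ring
      rw [hq]
      generalize SC ρ1 ρ2 τ1 τ2 (fun v => 1 / ((z0 - c + w0) / h - v)) = X at n2
      generalize (z0 - c + w0) / (h:ℂ) = p at n2 p0
      have : X = w0 ^ 2 / (p * (z0 ^ 2 - 1)) := by
        rw [eq_div_iff (mul_ne_zero p0 z00)]; exact n2
      rw [this]
      field_simp
    rw [e'] at hs
    exact hs
  · filter_upwards [hWsq] with z hzW hzG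
    obtain ⟨hz', hz2'⟩ := hG z hzG
    have q := p_facts H (z := z) (w := W z) hzW rfl hz'.1 hz'.2
    rw [Floc_re n1 q.1, hz2 w0 hw0, hz2' (W z) hzW, sub_self]

lemma exists_w (c h : ℝ) (z : ℂ) : ∃ w : ℂ, w ^ 2 = (z - c) ^ 2 + (h : ℂ) ^ 2 :=
  IsAlgClosed.exists_pow_nat_eq _ (by norm_num)

lemma tangent (H : Par c h ρ1 ρ2 τ1 τ2) {G : Set ℂ} (hG : Lev c h ρ1 ρ2 τ1 τ2 G) {w0 : ℂ}
    {γ : ℝ → ℂ} {γ' : ℂ} {s : ℝ} (hγ : HasDerivAt γ γ' s) (hm : ∀ᶠ t in 𝓝 s, γ t ∈ G)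
    (hw0 : w0 ^ 2 = (γ s - c) ^ 2 + (h : ℂ) ^ 2) (w00 : w0 ≠ 0) :
    (w0 / (γ s ^ 2 - 1) * γ').re = 0 := by
  obtain ⟨Φ, h1, h2⟩ := chart H hG hm.self_of_nhds hw0 w00
  have hd := Complex.reCLM.hasFDerivAt.comp_hasDerivAt s (h1.hasDerivAt.comp s hγ)
  have hz : HasDerivAt (Complex.reCLM ∘ Φ ∘ γ) 0 s := by
    refine (hasDerivAt_const s (0:ℝ)).congr_of_eventuallyEq ?_
    filter_upwards [hm, hγ.continuousAt.eventually h2] with t a b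
    simpa using b a
  simpa using hd.unique hz

lemma cover (H : Par c h ρ1 ρ2 τ1 τ2) {G : Set ℂ} (hG : Lev c h ρ1 ρ2 τ1 τ2 G)
    {γ : ℝ → ℂ} (hγ : ContDiff ℝ 1 γ) {s : ℝ} (hs : s ∈ Ioo (0:ℝ) 1) (hd : deriv γ s ≠ 0)
    (hm : ∀ t ∈ Icc (0:ℝ) 1, γ t ∈ G)
    (hn : (γ s - c) ^ 2 + (h : ℂ) ^ 2 ≠ 0) :
    ∀ᶠ z in 𝓝 (γ s), z ∈ G → z ∈ γ '' Icc 0 1 := by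
  obtain ⟨w0, hw0⟩ := exists_w c h (γ s)
  have w00 : w0 ≠ 0 := by
    rintro rfl; exact hn (by rw [← hw0]; simp)
  have hnh : Icc (0:ℝ) 1 ∈ 𝓝 s := Icc_mem_nhds hs.1 hs.2
  have hms : ∀ᶠ t in 𝓝 s, γ t ∈ G := by filter_upwards [hnh] with t ht using hm t ht
  have hγs : HasStrictDerivAt γ (deriv γ s) s := hγ.contDiffAt.hasStrictDerivAt one_ne_zero
  have hre := tangent H hG hγs.hasDerivAt hms hw0 w00
  have hzG := hms.self_of_nhds
  have z00 := sq_sub_one_ne (hG _ hzG).1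
  obtain ⟨Φ, h1, h2⟩ := chart H hG hzG hw0 w00
  set d := w0 / (γ s ^ 2 - 1) with hdd
  have d0 : d ≠ 0 := div_ne_zero w00 z00
  have hψ : HasStrictDerivAt (fun t => (Φ (γ t)).im) ((d * deriv γ s).im) s := by
    have := h1.comp s hγs
    exact Complex.imCLM.hasStrictFDerivAt.comp_hasStrictDerivAt s this
  have him : (d * deriv γ s).im ≠ 0 := by
    intro h
    exact (mul_ne_zero d0 hd) (Complex.ext (by simpa using hre) (by simpa using h))
  have hmap := hψ.map_nhds_eq him
  obtain ⟨Ψ, hΨ⟩ : ∃ Ψ : ℂ → ℂ, ∀ᶠ z in 𝓝 (γ s), Ψ (Φ z) = z :=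
    ⟨_, (h1.hasStrictFDerivAt_equiv d0).eventually_left_inverse⟩
  have hN : {t | t ∈ Icc (0:ℝ) 1 ∧ Ψ (Φ (γ t)) = γ t ∧ (Φ (γ t)).re = 0} ∈ 𝓝 s := by
    filter_upwards [hnh, hγ.continuous.continuousAt.eventually hΨ,
      hγ.continuous.continuousAt.eventually h2] with t a b e
    exact ⟨a, b, e (hm t a)⟩
  have hI := Filter.image_mem_map (m := fun t => (Φ (γ t)).im) hN
  rw [hmap] at hI
  have hc : ContinuousAt (fun z => (Φ z).im) (γ s) :=
    Complex.continuous_im.continuousAt.comp h1.hasDerivAt.continuousAt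
  filter_upwards [hΨ, h2, hc.eventually hI] with z a b e hz
  obtain ⟨t, ⟨t1, t2, t3⟩, t4⟩ := e
  refine ⟨t, t1, ?_⟩
  rw [← t2, ← a]
  congr 1
  exact Complex.ext (by rw [t3, b hz]) t4

lemma disjoint_arcs (H : Par c h ρ1 ρ2 τ1 τ2) {G : Set ℂ} (hG : Lev c h ρ1 ρ2 τ1 τ2 G)
    {γ1 γ2 : ℝ → ℂ} (hγ1 : Continuous γ1) (hγ2 : ContDiff ℝ 1 γ2)
    (hd : ∀ t ∈ Icc (0:ℝ) 1, deriv γ2 t ≠ 0)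
    (hm1 : ∀ t ∈ Icc (0:ℝ) 1, γ1 t ∈ G) (hm2 : ∀ t ∈ Icc (0:ℝ) 1, γ2 t ∈ G)
    (hn1 : ∀ t ∈ Ioo (0:ℝ) 1, (γ1 t - c) ^ 2 + (h : ℂ) ^ 2 ≠ 0)
    (h20 : (γ2 0 - c) ^ 2 + (h : ℂ) ^ 2 = 0) (h21 : (γ2 1 - c) ^ 2 + (h : ℂ) ^ 2 = 0)
    (hex : ∃ t ∈ Ioo (0:ℝ) 1, γ1 t ∉ γ2 '' Icc 0 1) :
    ∀ t ∈ Ioo (0:ℝ) 1, γ1 t ∉ γ2 '' Icc 0 1 := by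
  by_contra hcon
  push Not at hcon
  obtain ⟨t1, ht1, ht1'⟩ := hcon
  obtain ⟨t2, ht2, ht2'⟩ := hex
  have hcl : IsClosed (γ2 '' Icc (0:ℝ) 1) := (isCompact_Icc.image hγ2.continuous).isClosed
  have hU : IsOpen {t | t ∈ Ioo (0:ℝ) 1 ∧ γ1 t ∈ γ2 '' Icc 0 1} := by
    rw [isOpen_iff_mem_nhds]
    rintro t ⟨ht, s, hs, hst⟩
    have hs' : s ∈ Ioo (0:ℝ) 1 := by
      rcases eq_or_lt_of_le hs.1 with h | h
      · exact absurd (by rw [← hst, ← h]; exact h20) (hn1 t ht)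
      rcases eq_or_lt_of_le hs.2 with h' | h'
      · exact absurd (by rw [← hst, h']; exact h21) (hn1 t ht)
      exact ⟨h, h'⟩
    have := cover H hG hγ2 hs' (hd s hs) hm2 (by rw [hst]; exact hn1 t ht)
    rw [hst] at this
    filter_upwards [hγ1.continuousAt.eventually this, Ioo_mem_nhds ht.1 ht.2] with r a b
    exact ⟨b, a (hm1 r (Ioo_subset_Icc_self b))⟩
  have hV : IsOpen {t | γ1 t ∉ γ2 '' Icc (0:ℝ) 1} := hcl.isOpen_compl.preimage hγ1
  obtain ⟨t, -, a, b⟩ := isPreconnected_Ioo _ _ hU hV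
    (fun t ht => by
      by_cases hx : γ1 t ∈ γ2 '' Icc (0:ℝ) 1
      · exact Or.inl ⟨ht, hx⟩
      · exact Or.inr hx) ⟨t1, ht1, ht1, ht1'⟩ ⟨t2, ht2, ht2'⟩
  exact b a.2

end par3

section par4
variable {c h ρ1 ρ2 τ1 τ2 : ℝ}

lemma real_p (H : Par c h ρ1 ρ2 τ1 τ2) {z w p : ℂ}
    (hw : w ^ 2 = (z - c) ^ 2 + (h : ℂ) ^ 2) (hp : p = (z - c + w) / h) (him : p.im = 0) :
    z.im = 0 ∧ p.re ≠ 0 ∧ h * (p.re ^ 2 - 1) = 2 * (z.re - c) * p.re ∧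
      h * (p.re ^ 2 + 1) = 2 * w.re * p.re := by
  have hh : (h : ℂ) ≠ 0 := by exact_mod_cast H.h0.ne'
  obtain ⟨p0, a, b⟩ := p_basic hh hw hp
  obtain ⟨r, rfl⟩ : ∃ r : ℝ, p = r := ⟨p.re, Complex.ext (by simp) (by simpa using him)⟩
  have r0 : r ≠ 0 := by simpa using p0
  have a1 := congrArg Complex.re a
  have a2 := congrArg Complex.im a
  have b1 := congrArg Complex.re b
  simp [← Complex.ofReal_pow] at a1 a2 b1
  refine ⟨a2.resolve_left r0, by simpa using r0, ?_, ?_⟩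
  · simp; linarith
  · simp; linarith

lemma tau_cmp {h c r x τ y : ℝ} (h1 : h * (r ^ 2 - 1) = 2 * (x - c) * r)
    (h2 : h * (τ ^ 2 - 1) = 2 * (y - c) * τ) :
    h * (r - τ) * (r * τ + 1) = 2 * (r * τ) * (x - y) := by
  linear_combination τ * h1 - r * h2

lemma slit_pos {p : ℂ} {v : ℝ} (hv : p.im = 0 → v < p.re) : 1 * (p - v) ∈ slitPlane := by
  rw [one_mul, Complex.mem_slitPlane_iff]
  by_cases hp : p.im = 0
  · left; simpa using hv hp
  · right; simpa using hp

lemma slit_neg {p : ℂ} {v : ℝ} (hv : p.im = 0 → p.re < v) : -1 * (p - v) ∈ slitPlane := by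
  rw [Complex.mem_slitPlane_iff]
  by_cases hp : p.im = 0
  · left; simpa using hv hp
  · right; simpa using hp

lemma arg_I_sub (v : ℝ) : Complex.arg (I - v) = Real.pi / 2 + Real.arctan v := by
  have hr : 0 < Real.sqrt (1 + v ^ 2) := Real.sqrt_pos.2 (by positivity)
  have e : I - (v:ℂ) = (Real.sqrt (1 + v ^ 2) : ℝ) *
      (Complex.cos ((Real.pi / 2 + Real.arctan v : ℝ):ℂ) +
        Complex.sin ((Real.pi / 2 + Real.arctan v : ℝ):ℂ) * I) := by
    rw [← Complex.ofReal_cos, ← Complex.ofReal_sin, add_comm (Real.pi / 2), Real.cos_add_pi_div_two,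
      Real.sin_add_pi_div_two, Real.cos_arctan, Real.sin_arctan]
    apply Complex.ext
    · simp; field_simp
    · simp; field_simp
  rw [e, Complex.arg_mul_cos_add_sin_mul_I hr]
  have := Real.neg_pi_div_two_lt_arctan v
  have := Real.arctan_lt_pi_div_two v
  constructor <;> linarith [Real.pi_pos]

lemma log_conj_sub {z : ℂ} (hz : z.arg ≠ Real.pi) :
    Complex.log z - Complex.log (starRingEnd ℂ z) = 2 * z.arg * I := by
  rw [Complex.log_conj z hz]
  apply Complex.ext
  · simp
  · simp [Complex.log_im]; ring

lemma delta_pos (v : ℝ) : Complex.log (1 * (I - v)) - Complex.log (1 * (-I - v)) =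
    I * (2 * Real.arctan v + Real.pi) := by
  have e : (1 * (-I - v) : ℂ) = starRingEnd ℂ (I - v) := by simp
  have := Real.arctan_lt_pi_div_two v
  rw [e, one_mul, log_conj_sub, arg_I_sub]
  · push_cast; ring
  · rw [arg_I_sub]; intro h; linarith

lemma delta_neg (v : ℝ) : Complex.log (-1 * (I - v)) - Complex.log (-1 * (-I - v)) =
    I * (2 * Real.arctan v - Real.pi) := by
  have e1 : (-1 * (-I - v) : ℂ) = I - ((-v : ℝ) : ℂ) := by push_cast; ring
  have e2 : (-1 * (I - v) : ℂ) = starRingEnd ℂ (I - ((-v : ℝ) : ℂ)) := by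
    simp; ring
  have := Real.arctan_lt_pi_div_two (-v)
  rw [e1, e2, ← neg_sub, log_conj_sub, arg_I_sub, Real.arctan_neg]
  · push_cast; ring
  · rw [arg_I_sub]; intro h; linarith

lemma arctan_diff {τ : ℝ} (ht : 0 < τ) :
    Real.arctan (-1 / τ) = Real.arctan τ - Real.pi / 2 := by
  have e : -1 / τ = -τ⁻¹ := by field_simp
  rw [e, Real.arctan_neg, Real.arctan_inv_of_pos ht]; ring

lemma tau_lt (H : Par c h ρ1 ρ2 τ1 τ2) : τ2 < τ1 := by
  have := tau_cmp H.e1 H.e2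
  have h0 := H.h0
  have h1 := H.t1
  have h2 := H.t2
  by_contra hcon
  push Not at hcon
  have a : h * (τ1 - τ2) * (τ1 * τ2 + 1) ≤ 0 := by
    apply mul_nonpos_of_nonpos_of_nonneg
    · exact mul_nonpos_of_nonneg_of_nonpos h0.le (by linarith)
    · positivity
  have : 0 < 2 * (τ1 * τ2) * (1 - (-1)) := by positivity
  linarith

lemma endpoint_p (H : Par c h ρ1 ρ2 τ1 τ2) {z w : ℂ}
    (hw : w ^ 2 = (z - c) ^ 2 + (h : ℂ) ^ 2) :
    (z = c + h * I → (z - c + w) / h = I) ∧ (z = c - h * I → (z - c + w) / h = -I) := by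
  have hh : (h : ℂ) ≠ 0 := by exact_mod_cast H.h0.ne'
  constructor
  · intro hz
    have : w = 0 := by
      have : w ^ 2 = 0 := by rw [hw, hz]; linear_combination (h:ℂ) ^ 2 * Complex.I_sq
      simpa using this
    rw [hz, this]; field_simp; ring
  · intro hz
    have : w = 0 := by
      have : w ^ 2 = 0 := by rw [hw, hz]; linear_combination (h:ℂ) ^ 2 * Complex.I_sq
      simpa using this
    rw [hz, this]; field_simp; ring

lemma eval_R (H : Par c h ρ1 ρ2 τ1 τ2) {γ g : ℝ → ℂ} (hγ : ContDiff ℝ 1 γ)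
    (hg : ContinuousOn g (Icc 0 1))
    (hsq : ∀ t ∈ Icc (0:ℝ) 1, g t ^ 2 = (γ t - c) ^ 2 + (h:ℂ) ^ 2)
    (h1 : ∀ t ∈ Icc (0:ℝ) 1, γ t ≠ 1 ∧ γ t ≠ -1)
    (h0 : ∀ t ∈ Ioo (0:ℝ) 1, g t ≠ 0)
    (e0 : γ 0 = c - h * I) (e1 : γ 1 = c + h * I)
    (hc : ∀ t ∈ Icc (0:ℝ) 1, (γ t).im = 0 → 1 < (γ t).re ∧ 0 < (g t).re) :
    (∫ t in (0:ℝ)..1, g t / ((γ t) ^ 2 - 1) * deriv γ t) =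
      Real.pi * I * (1 + ρ1 / 2 - ρ2 / 2) := by
  have t1 := H.t1
  have t2 := H.t2
  have hh := H.h0
  have t12 := tau_lt H
  have key : ∀ t ∈ Icc (0:ℝ) 1, ((γ t - c + g t) / (h:ℂ)).im = 0 →
      τ1 < ((γ t - c + g t) / (h:ℂ)).re := by
    intro t ht hi
    obtain ⟨a, b, d, e⟩ := real_p H (hsq t ht) rfl hi
    obtain ⟨q1, q2⟩ := hc t ht a
    set r := ((γ t - c + g t) / (h:ℂ)).re
    have rp : 0 < r := by
      have : 0 < 2 * (g t).re * r := by rw [← e]; positivity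
      exact pos_of_mul_pos_right this (by positivity)
    have := tau_cmp d H.e1
    have h3 : 0 < h * (r - τ1) * (r * τ1 + 1) := by
      rw [this]; have : 0 < (γ t).re - 1 := by linarith
      positivity
    have h4 : 0 < h * (r - τ1) := pos_of_mul_pos_left h3 (by positivity)
    have h5 := pos_of_mul_pos_right h4 hh.le
    linarith
  have n1 : -1 / τ1 < 0 := by apply div_neg_of_neg_of_pos <;> linarith
  have n2 : -1 / τ2 < 0 := by apply div_neg_of_neg_of_pos <;> linarith
  have := curve_integral H hγ hg hsq h1 h0 (fun _ => 1) (by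
    rw [Vs_forall]
    refine ⟨fun t ht => slit_pos fun hi => ?_, fun t ht => slit_pos fun hi => ?_,
      fun t ht => slit_pos fun hi => ?_, fun t ht => slit_pos fun hi => ?_,
      fun t ht => slit_pos fun hi => ?_⟩ <;> linarith [key t ht hi])
  rw [this, (endpoint_p H (hsq 0 (by simp))).2 e0, (endpoint_p H (hsq 1 (by simp))).1 e1, ← SC_sub]
  simp only [delta_pos, SC, arctan_diff t1, arctan_diff t2, Real.arctan_zero]
  push_cast
  ring

lemma eval_C (H : Par c h ρ1 ρ2 τ1 τ2) {γ g : ℝ → ℂ} (hγ : ContDiff ℝ 1 γ)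
    (hg : ContinuousOn g (Icc 0 1))
    (hsq : ∀ t ∈ Icc (0:ℝ) 1, g t ^ 2 = (γ t - c) ^ 2 + (h:ℂ) ^ 2)
    (h1 : ∀ t ∈ Icc (0:ℝ) 1, γ t ≠ 1 ∧ γ t ≠ -1)
    (h0 : ∀ t ∈ Ioo (0:ℝ) 1, g t ≠ 0)
    (e0 : γ 0 = c + h * I) (e1 : γ 1 = c - h * I)
    (hc : ∀ t ∈ Icc (0:ℝ) 1, (γ t).im = 0 → (-1 < (γ t).re ∧ (γ t).re < 1) ∧ 0 < (g t).re) :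
    -(∫ t in (0:ℝ)..1, g t / ((γ t) ^ 2 - 1) * deriv γ t) =
      Real.pi * I * (1 - ρ1 / 2 - ρ2 / 2) := by
  have t1 := H.t1
  have t2 := H.t2
  have hh := H.h0
  have t12 := tau_lt H
  have key : ∀ t ∈ Icc (0:ℝ) 1, ((γ t - c + g t) / (h:ℂ)).im = 0 →
      τ2 < ((γ t - c + g t) / (h:ℂ)).re ∧ ((γ t - c + g t) / (h:ℂ)).re < τ1 := by
    intro t ht hi
    obtain ⟨a, b, d, e⟩ := real_p H (hsq t ht) rfl hi
    obtain ⟨⟨q1, q3⟩, q2⟩ := hc t ht a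
    set r := ((γ t - c + g t) / (h:ℂ)).re
    have rp : 0 < r := by
      have : 0 < 2 * (g t).re * r := by rw [← e]; positivity
      exact pos_of_mul_pos_right this (by positivity)
    constructor
    · have := tau_cmp d H.e2
      have h3 : 0 < h * (r - τ2) * (r * τ2 + 1) := by
        rw [this]; have : 0 < (γ t).re - (-1) := by linarith
        positivity
      have h4 : 0 < h * (r - τ2) := pos_of_mul_pos_left h3 (by positivity)
      have h5 := pos_of_mul_pos_right h4 hh.le
      linarith
    · have := tau_cmp H.e1 d
      have h3 : 0 < h * (τ1 - r) * (τ1 * r + 1) := by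
        rw [this]; have : 0 < 1 - (γ t).re := by linarith
        positivity
      have h4 : 0 < h * (τ1 - r) := pos_of_mul_pos_left h3 (by positivity)
      have h5 := pos_of_mul_pos_right h4 hh.le
      linarith
  have n1 : -1 / τ1 < 0 := by apply div_neg_of_neg_of_pos <;> linarith
  have n2 : -1 / τ2 < 0 := by apply div_neg_of_neg_of_pos <;> linarith
  have ε0 : (if (0:ℝ) < τ1 then (1:ℂ) else -1) = 1 := if_pos t1
  have ε1 : (if τ1 < τ1 then (1:ℂ) else -1) = -1 := if_neg (lt_irrefl _)
  have ε2 : (if -1 / τ1 < τ1 then (1:ℂ) else -1) = 1 := if_pos (by linarith)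
  have ε3 : (if τ2 < τ1 then (1:ℂ) else -1) = 1 := if_pos t12
  have ε4 : (if -1 / τ2 < τ1 then (1:ℂ) else -1) = 1 := if_pos (by linarith)
  have := curve_integral H hγ hg hsq h1 h0 (fun v => if v < τ1 then 1 else -1) (by
    rw [Vs_forall]
    simp only [ε0, ε1, ε2, ε3, ε4]
    refine ⟨fun t ht => slit_pos fun hi => ?_, fun t ht => slit_neg fun hi => ?_,
      fun t ht => slit_pos fun hi => ?_, fun t ht => slit_pos fun hi => ?_,
      fun t ht => slit_pos fun hi => ?_⟩ <;> linarith [(key t ht hi).1, (key t ht hi).2])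
  rw [this, (endpoint_p H (hsq 0 (by simp))).1 e0, (endpoint_p H (hsq 1 (by simp))).2 e1, neg_sub,
    ← SC_sub]
  simp only [SC, ε0, ε1, ε2, ε3, ε4]
  simp only [delta_pos, delta_neg, arctan_diff t1, arctan_diff t2, Real.arctan_zero]
  push_cast
  ring

lemma eval_L (H : Par c h ρ1 ρ2 τ1 τ2) {γ g : ℝ → ℂ} (hγ : ContDiff ℝ 1 γ)
    (hg : ContinuousOn g (Icc 0 1))
    (hsq : ∀ t ∈ Icc (0:ℝ) 1, g t ^ 2 = (γ t - c) ^ 2 + (h:ℂ) ^ 2)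
    (h1 : ∀ t ∈ Icc (0:ℝ) 1, γ t ≠ 1 ∧ γ t ≠ -1)
    (h0 : ∀ t ∈ Ioo (0:ℝ) 1, g t ≠ 0)
    (e0 : γ 0 = c + h * I) (e1 : γ 1 = c - h * I)
    (hc : ∀ t ∈ Icc (0:ℝ) 1, (γ t).im = 0 → (γ t).re < -1 ∧ (g t).re < 0) :
    -(∫ t in (0:ℝ)..1, g t / ((γ t) ^ 2 - 1) * deriv γ t) =
      Real.pi * I * (-1 + ρ1 / 2 - ρ2 / 2) := by
  have t1 := H.t1
  have t2 := H.t2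
  have hh := H.h0
  have t12 := tau_lt H
  have key : ∀ t ∈ Icc (0:ℝ) 1, ((γ t - c + g t) / (h:ℂ)).im = 0 →
      ((γ t - c + g t) / (h:ℂ)).re < -1 / τ2 := by
    intro t ht hi
    obtain ⟨a, b, d, e⟩ := real_p H (hsq t ht) rfl hi
    obtain ⟨q1, q2⟩ := hc t ht a
    set r := ((γ t - c + g t) / (h:ℂ)).re
    have rp : r < 0 := by
      have : 0 < 2 * (g t).re * r := by rw [← e]; positivity
      nlinarith
    have := tau_cmp d H.e2
    have h3 : 0 < h * (r - τ2) * (r * τ2 + 1) := by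
      rw [this]
      have h7 : (γ t).re - (-1) < 0 := by linarith
      have h8 : 2 * (r * τ2) < 0 := by nlinarith
      exact mul_pos_of_neg_of_neg h8 h7
    have h4 : h * (r - τ2) < 0 := mul_neg_of_pos_of_neg hh (by linarith)
    have h5 : r * τ2 + 1 < 0 := by
      by_contra hcon
      push Not at hcon
      have := mul_nonpos_of_nonpos_of_nonneg h4.le hcon
      linarith
    rw [lt_div_iff₀ t2]; linarith
  have n1 : -1 / τ1 < 0 := by apply div_neg_of_neg_of_pos <;> linarith
  have n2 : -1 / τ2 < 0 := by apply div_neg_of_neg_of_pos <;> linarith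
  have n3 : -1 / τ2 < -1 / τ1 := by
    rw [div_lt_div_iff₀ t2 t1]; linarith
  have := curve_integral H hγ hg hsq h1 h0 (fun _ => -1) (by
    rw [Vs_forall]
    refine ⟨fun t ht => slit_neg fun hi => ?_, fun t ht => slit_neg fun hi => ?_,
      fun t ht => slit_neg fun hi => ?_, fun t ht => slit_neg fun hi => ?_,
      fun t ht => slit_neg fun hi => ?_⟩ <;> linarith [key t ht hi])
  rw [this, (endpoint_p H (hsq 0 (by simp))).1 e0, (endpoint_p H (hsq 1 (by simp))).2 e1, neg_sub,
    ← SC_sub]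
  simp only [delta_neg, SC, arctan_diff t1, arctan_diff t2, Real.arctan_zero]
  push_cast
  ring

lemma real_unique (H : Par c h ρ1 ρ2 τ1 τ2) {G : Set ℂ} (hG : Lev c h ρ1 ρ2 τ1 τ2 G)
    {x y : ℝ} (hx : (x:ℂ) ∈ G) (hy : (y:ℂ) ∈ G) (hx1 : -1 < x) (hxy : x < y) (hy1 : y < 1) :
    False := by
  have hh := H.h0
  set ℓ : ℝ → ℝ := fun t => x + t * (y - x) with hℓ
  set q : ℝ → ℝ := fun t => Real.sqrt ((ℓ t - c) ^ 2 + h ^ 2) with hq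
  have hb : ∀ t ∈ Icc (0:ℝ) 1, -1 < ℓ t ∧ ℓ t < 1 := by
    intro t ht
    simp only [hℓ]
    constructor <;> nlinarith [ht.1, ht.2]
  have cℓ : Continuous ℓ := by simp only [hℓ]; fun_prop
  have cq : Continuous q := by simp only [hq]; fun_prop
  have hder : ∀ t, HasDerivAt (fun t => ((ℓ t : ℝ) : ℂ)) ((y - x : ℝ) : ℂ) t := by
    intro t
    have : HasDerivAt ℓ (y - x) t := by
      exact (((hasDerivAt_id t).mul_const (y - x)).const_add x).congr_deriv (by simp)
    exact this.ofReal_comp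
  have hC1 : ContDiff ℝ 1 (fun t => ((ℓ t : ℝ) : ℂ)) := by
    have : ContDiff ℝ 1 ℓ := by
      show ContDiff ℝ 1 (fun t => x + t * (y - x))
      fun_prop
    exact Complex.ofRealCLM.contDiff.comp this
  have hsq : ∀ t ∈ Icc (0:ℝ) 1, ((q t : ℝ) : ℂ) ^ 2 = (((ℓ t : ℝ) : ℂ) - c) ^ 2 + (h:ℂ) ^ 2 := by
    intro t _
    have : q t ^ 2 = (ℓ t - c) ^ 2 + h ^ 2 := Real.sq_sqrt (by positivity)
    exact_mod_cast this
  have hne : ∀ t ∈ Icc (0:ℝ) 1, ((ℓ t : ℝ) : ℂ) ≠ 1 ∧ ((ℓ t : ℝ) : ℂ) ≠ -1 := by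
    intro t ht
    constructor
    · intro h; have : ℓ t = 1 := by exact_mod_cast h
      linarith [(hb t ht).2]
    · intro h; have : ℓ t = -1 := by exact_mod_cast h
      linarith [(hb t ht).1]
  have R := re_integral H (γ := fun t => ((ℓ t : ℝ) : ℂ)) (g := fun t => ((q t : ℝ) : ℂ)) hC1
    (Complex.continuous_ofReal.comp cq).continuousOn hsq hne
  have m0 := hsq 0 (by simp)
  have m1 := hsq 1 (by simp)
  have l0 : ℓ 0 = x := by simp [hℓ]
  have l1 : ℓ 1 = y := by simp [hℓ]
  rw [l0] at m0
  rw [l1] at m1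
  simp only [l0, l1] at R
  rw [(hG _ hx).2 _ m0, (hG _ hy).2 _ m1, sub_self] at R
  have e : (fun t => ((q t : ℝ) : ℂ) / (((ℓ t : ℝ) : ℂ) ^ 2 - 1) * deriv (fun t => ((ℓ t : ℝ) : ℂ)) t)
      = fun t => ((q t / (ℓ t ^ 2 - 1) * (y - x) : ℝ) : ℂ) := by
    funext t
    rw [(hder t).deriv]; push_cast; rfl
  rw [e, intervalIntegral.integral_ofReal, Complex.ofReal_re] at R
  have hneg : ∀ t ∈ Icc (0:ℝ) 1, q t / (ℓ t ^ 2 - 1) * (y - x) < 0 := by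
    intro t ht
    have q0 : 0 < q t := Real.sqrt_pos.2 (by positivity)
    have : ℓ t ^ 2 - 1 < 0 := by nlinarith [(hb t ht).1, (hb t ht).2]
    exact mul_neg_of_neg_of_pos (div_neg_of_pos_of_neg q0 this) (by linarith)
  have hpos : 0 < ∫ t in (0:ℝ)..1, -(q t / (ℓ t ^ 2 - 1) * (y - x)) := by
    apply intervalIntegral.intervalIntegral_pos_of_pos_on
    · apply ContinuousOn.intervalIntegrable
      rw [uIcc_of_le zero_le_one]
      refine ((cq.continuousOn.div ((cℓ.pow 2).sub continuous_const).continuousOn ?_).mul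
        continuousOn_const).neg
      intro t ht h0
      have h0' : ℓ t ^ 2 - 1 = 0 := h0
      nlinarith [(hb t ht).1, (hb t ht).2]
    · intro t ht
      linarith [hneg t (Ioo_subset_Icc_self ht)]
    · norm_num
  rw [intervalIntegral.integral_neg, R] at hpos
  simp at hpos

lemma real_sqrt_facts (hh : 0 < h) {w : ℂ} {x : ℝ} (hw : w ^ 2 = ((x:ℂ) - c) ^ 2 + (h:ℂ) ^ 2) :
    w.im = 0 ∧ w.re ≠ 0 := by
  have a := congrArg Complex.re hw
  have b := congrArg Complex.im hw
  have e : ((x:ℂ) - c) ^ 2 + (h:ℂ) ^ 2 = (((x - c) ^ 2 + h ^ 2 : ℝ) : ℂ) := by push_cast; rfl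
  rw [e, Complex.ofReal_re] at a
  rw [e, Complex.ofReal_im] at b
  simp [pow_two] at a b
  have hr : w.re ≠ 0 := by
    intro h0
    rw [h0] at a
    nlinarith [sq_nonneg (x - c), sq_nonneg w.im]
  refine ⟨?_, hr⟩
  have : w.re * w.im = 0 := by linarith
  exact (mul_eq_zero.1 this).resolve_left hr

lemma R_pos (hh : 0 < h) {R : ℂ → ℂ} {K : Set ℂ} (hK : IsClosed K)
    (hR : DifferentiableOn ℂ R Kᶜ) (hsq : ∀ z ∉ K, R z ^ 2 = (z - c) ^ 2 + (h:ℂ) ^ 2)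
    (hT : Tendsto (fun z => R z / z) (cobounded ℂ) (𝓝 1)) {x0 : ℝ}
    (hx : ∀ x : ℝ, x0 < x → (x:ℂ) ∉ K) {x : ℝ} (hxx : x0 < x) : 0 < (R x).re := by
  have hcont : ContinuousOn (fun x : ℝ => (R x).re) (Ioi x0) := by
    apply Complex.continuous_re.comp_continuousOn
    exact hR.continuousOn.comp Complex.continuous_ofReal.continuousOn (fun y hy => hx y hy)
  have hlim : Tendsto (fun x : ℝ => R x / x) atTop (𝓝 1) := by
    have : Tendsto (fun x : ℝ => (x:ℂ)) atTop (cobounded ℂ) := by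
      rw [← tendsto_norm_atTop_iff_cobounded]
      simpa using tendsto_abs_atTop_atTop
    exact hT.comp this
  have hre : Tendsto (fun x : ℝ => (R x / x).re) atTop (𝓝 1) := by
    have := (Complex.continuous_re.tendsto _).comp hlim
    rw [Complex.one_re] at this
    exact this
  have hev : ∀ᶠ y : ℝ in atTop, x ≤ y ∧ 0 < (R y).re := by
    filter_upwards [hre.eventually_const_lt (by norm_num : (0:ℝ) < 1), eventually_gt_atTop 0,
      eventually_ge_atTop x] with y a b d
    refine ⟨d, ?_⟩
    rw [Complex.div_ofReal_re] at a
    exact (div_pos_iff_of_pos_right b).1 a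
  obtain ⟨y, hy, hy2⟩ := hev.exists
  by_contra hcon
  push Not at hcon
  obtain ⟨s, hs, hs0⟩ := intermediate_value_Icc hy
    (hcont.mono (fun s hs => lt_of_lt_of_le hxx hs.1)) ⟨hcon, hy2.le⟩
  exact (real_sqrt_facts hh (hsq s (hx s (lt_of_lt_of_le hxx hs.1)))).2 hs0

lemma R_neg (hh : 0 < h) {R : ℂ → ℂ} {K : Set ℂ} (hK : IsClosed K)
    (hR : DifferentiableOn ℂ R Kᶜ) (hsq : ∀ z ∉ K, R z ^ 2 = (z - c) ^ 2 + (h:ℂ) ^ 2)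
    (hT : Tendsto (fun z => R z / z) (cobounded ℂ) (𝓝 1)) {x0 : ℝ}
    (hx : ∀ x : ℝ, x < x0 → (x:ℂ) ∉ K) {x : ℝ} (hxx : x < x0) : (R x).re < 0 := by
  have hcont : ContinuousOn (fun x : ℝ => (R x).re) (Iio x0) := by
    apply Complex.continuous_re.comp_continuousOn
    exact hR.continuousOn.comp Complex.continuous_ofReal.continuousOn (fun y hy => hx y hy)
  have hlim : Tendsto (fun x : ℝ => R x / x) atBot (𝓝 1) := by
    have : Tendsto (fun x : ℝ => (x:ℂ)) atBot (cobounded ℂ) := by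
      rw [← tendsto_norm_atTop_iff_cobounded]
      simpa using tendsto_abs_atBot_atTop
    exact hT.comp this
  have hre : Tendsto (fun x : ℝ => (R x / x).re) atBot (𝓝 1) := by
    have := (Complex.continuous_re.tendsto _).comp hlim
    rw [Complex.one_re] at this
    exact this
  have hev : ∀ᶠ y : ℝ in atBot, y ≤ x ∧ (R y).re < 0 := by
    filter_upwards [hre.eventually_const_lt (by norm_num : (0:ℝ) < 1), eventually_lt_atBot 0,
      eventually_le_atBot x] with y a b d
    refine ⟨d, ?_⟩
    rw [Complex.div_ofReal_re] at a
    by_contra hcon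
    push Not at hcon
    linarith [div_nonpos_of_nonneg_of_nonpos hcon b.le]
  obtain ⟨y, hy, hy2⟩ := hev.exists
  by_contra hcon
  push Not at hcon
  obtain ⟨s, hs, hs0⟩ := intermediate_value_Icc hy
    (hcont.mono (fun s hs => lt_of_le_of_lt hs.2 hxx)) ⟨hy2.le, hcon⟩
  exact (real_sqrt_facts hh (hsq s (hx s (lt_of_le_of_lt hs.2 hxx)))).2 hs0

lemma arc_lift {γ : ℝ → ℂ} (hγ : Continuous γ) {R : ℂ → ℂ} {K : Set ℂ} (hK : IsClosed K)
    (hR : DifferentiableOn ℂ R Kᶜ) (hsq : ∀ z ∉ K, R z ^ 2 = (z - c) ^ 2 + (h:ℂ) ^ 2)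
    (hd : ∀ t ∈ Ioo (0:ℝ) 1, γ t ∉ K)
    (h0 : (γ 0 - c) ^ 2 + (h:ℂ) ^ 2 = 0) (h1 : (γ 1 - c) ^ 2 + (h:ℂ) ^ 2 = 0) :
    ∃ g : ℝ → ℂ, ContinuousOn g (Icc 0 1) ∧
      (∀ t ∈ Icc (0:ℝ) 1, g t ^ 2 = (γ t - c) ^ 2 + (h:ℂ) ^ 2) ∧
      (∀ t ∈ Ioo (0:ℝ) 1, g t = R (γ t)) := by
  classical
  set g : ℝ → ℂ := fun t => if t ∈ Ioo (0:ℝ) 1 then R (γ t) else 0 with hg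
  have gI : ∀ t ∈ Ioo (0:ℝ) 1, g t = R (γ t) := fun t ht => if_pos ht
  have g0 : g 0 = 0 := if_neg (by simp)
  have g1 : g 1 = 0 := if_neg (by simp)
  have gsq : ∀ t ∈ Icc (0:ℝ) 1, g t ^ 2 = (γ t - c) ^ 2 + (h:ℂ) ^ 2 := by
    intro t ht
    rcases eq_or_lt_of_le ht.1 with a | a
    · rw [← a, g0, h0]; simp
    rcases eq_or_lt_of_le ht.2 with b | b
    · rw [b, g1, h1]; simp
    rw [gI t ⟨a, b⟩, hsq _ (hd t ⟨a, b⟩)]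
  have hend : ∀ t ∈ Icc (0:ℝ) 1, g t = 0 → (γ t - c) ^ 2 + (h:ℂ) ^ 2 = 0 →
      ContinuousWithinAt g (Icc 0 1) t := by
    intro t ht gt hq
    unfold ContinuousWithinAt
    rw [gt, tendsto_zero_iff_norm_tendsto_zero]
    have hc : Continuous (fun s => Real.sqrt ‖(γ s - c) ^ 2 + (h:ℂ) ^ 2‖) := by fun_prop
    have := (hc.tendsto t).mono_left (nhdsWithin_le_nhds (s := Icc (0:ℝ) 1))
    rw [hq, norm_zero, Real.sqrt_zero] at this
    refine this.congr' ?_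
    filter_upwards [self_mem_nhdsWithin] with s hs
    rw [← gsq s hs, norm_pow, Real.sqrt_sq (norm_nonneg _)]
  refine ⟨g, ?_, gsq, gI⟩
  intro t ht
  rcases eq_or_lt_of_le ht.1 with a | a
  · rw [← a]; exact hend 0 (by simp) g0 h0
  rcases eq_or_lt_of_le ht.2 with b | b
  · rw [b]; exact hend 1 (by simp) g1 h1
  apply ContinuousAt.continuousWithinAt
  have hRc : ContinuousAt R (γ t) :=
    (hR.differentiableAt (hK.isOpen_compl.mem_nhds (hd t ⟨a, b⟩))).continuousAt
  have : ContinuousAt (fun s => R (γ s)) t := ContinuousAt.comp hRc hγ.continuousAt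
  refine this.congr ?_
  filter_upwards [Ioo_mem_nhds a b] with s hs using (gI s hs).symm

lemma integral_congr_Ioo' {f g : ℝ → ℂ} (hfg : ∀ t ∈ Ioo (0:ℝ) 1, f t = g t) :
    (∫ t in (0:ℝ)..1, f t) = ∫ t in (0:ℝ)..1, g t := by
  rw [intervalIntegral.integral_of_le zero_le_one, intervalIntegral.integral_of_le zero_le_one,
    MeasureTheory.integral_Ioc_eq_integral_Ioo, MeasureTheory.integral_Ioc_eq_integral_Ioo]
  exact MeasureTheory.setIntegral_congr_fun measurableSet_Ioo hfg

end par4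


lemma par_exists (A B : ℝ) (hA : -1 < A) (hA0 : A < 0) (hB : -1 < B) (hB0 : B < 0)
    (hAB : -2 < A + B) (hAB1 : A + B < -1) :
    ∃ c h ρ1 ρ2 τ1 τ2 : ℝ, Par c h ρ1 ρ2 τ1 τ2 ∧ zetaP A B = c + h * I ∧ zetaM A B = c - h * I ∧
      ρ1 = -2 * A / (A + B + 2) ∧ ρ2 = -2 * B / (A + B + 2) := by
  have hs : 0 < A + B + 2 := by linarith
  have hpos : 0 < (A + 1) * (B + 1) * (-A - B - 1) :=
    mul_pos (mul_pos (by linarith) (by linarith)) (by linarith)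
  have hS0 : 0 < Real.sqrt ((A + 1) * (B + 1) * (-A - B - 1)) := Real.sqrt_pos.2 hpos
  have hS2 : Real.sqrt ((A + 1) * (B + 1) * (-A - B - 1)) ^ 2 =
      (A + 1) * (B + 1) * (-A - B - 1) := Real.sq_sqrt hpos.le
  have hsC : (A : ℂ) + B + 2 ≠ 0 := by exact_mod_cast hs.ne'
  unfold zetaP zetaM
  generalize Real.sqrt ((A + 1) * (B + 1) * (-A - B - 1)) = S at hS0 hS2 ⊢
  obtain ⟨c, hc⟩ : ∃ c, c = (B ^ 2 - A ^ 2) / (A + B + 2) ^ 2 := ⟨_, rfl⟩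
  obtain ⟨h, hh⟩ : ∃ h, h = 4 * S / (A + B + 2) ^ 2 := ⟨_, rfl⟩
  obtain ⟨ρ1, h1⟩ : ∃ r, r = -2 * A / (A + B + 2) := ⟨_, rfl⟩
  obtain ⟨ρ2, h2⟩ : ∃ r, r = -2 * B / (A + B + 2) := ⟨_, rfl⟩
  have h0 : 0 < h := by rw [hh]; positivity
  have r1 : 0 < ρ1 := by rw [h1]; apply div_pos <;> linarith
  have r2 : 0 < ρ2 := by rw [h2]; apply div_pos <;> linarith
  have q1 : ρ1 ^ 2 = (1 - c) ^ 2 + h ^ 2 := by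
    rw [h1, hc, hh]; field_simp
    linear_combination (-16) * hS2
  have q2 : ρ2 ^ 2 = (-1 - c) ^ 2 + h ^ 2 := by
    rw [h2, hc, hh]; field_simp
    linear_combination (-16) * hS2
  have a1 : 0 < 1 - c + ρ1 := by
    by_contra hcon
    push Not at hcon
    nlinarith [mul_pos h0 h0]
  have a2 : 0 < -1 - c + ρ2 := by
    by_contra hcon
    push Not at hcon
    nlinarith [mul_pos h0 h0]
  refine ⟨c, h, ρ1, ρ2, (1 - c + ρ1) / h, (-1 - c + ρ2) / h, ?_, ?_, ?_, h1, h2⟩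
  · refine ⟨h0, div_pos a1 h0, div_pos a2 h0, ?_, ?_, ?_, ?_⟩
    · field_simp; linear_combination q1
    · field_simp; linear_combination -q1
    · field_simp; linear_combination q2
    · field_simp; linear_combination -q2
  · rw [hc, hh]; push_cast; field_simp
  · rw [hc, hh]; push_cast; field_simp

section par5
variable {c h ρ1 ρ2 τ1 τ2 : ℝ}

lemma exists_cross {γ : ℝ → ℂ} (hγ : Continuous γ)
    (hs : (γ 0).im < 0 ∧ 0 < (γ 1).im ∨ (γ 1).im < 0 ∧ 0 < (γ 0).im) :
    ∃ t ∈ Ioo (0:ℝ) 1, (γ t).im = 0 := by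
  have hc : ContinuousOn (fun t => (γ t).im) (Icc 0 1) :=
    (Complex.continuous_im.comp hγ).continuousOn
  rcases hs with ⟨a, b⟩ | ⟨a, b⟩
  · obtain ⟨t, ht, h⟩ := intermediate_value_Ioo zero_le_one hc ⟨a, b⟩
    exact ⟨t, ht, h⟩
  · obtain ⟨t, ht, h⟩ := intermediate_value_Ioo' zero_le_one hc ⟨a, b⟩
    exact ⟨t, ht, h⟩

lemma Q_ne {γ : ℝ → ℂ} (hi : InjOn γ (Icc 0 1)) {t : ℝ} (ht : t ∈ Ioo (0:ℝ) 1)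
    (he : γ 0 = c + h * I ∧ γ 1 = c - h * I ∨ γ 0 = c - h * I ∧ γ 1 = c + h * I) :
    (γ t - c) ^ 2 + (h:ℂ) ^ 2 ≠ 0 := by
  intro h0
  have e : (γ t - (c + h * I)) * (γ t - (c - h * I)) = 0 := by
    linear_combination h0 - (h:ℂ) ^ 2 * Complex.I_sq
  have n0 : γ t ≠ γ 0 := fun h => ht.1.ne' (hi (Ioo_subset_Icc_self ht) (by simp) h)
  have n1 : γ t ≠ γ 1 := fun h => ht.2.ne (hi (Ioo_subset_Icc_self ht) (by simp) h)
  rcases mul_eq_zero.1 e with e | e <;> rw [sub_eq_zero] at e <;>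
    rcases he with ⟨x, y⟩ | ⟨x, y⟩ <;> rw [x] at n0 <;> rw [y] at n1 <;> contradiction

lemma Q_end {z : ℂ} (he : z = c + h * I ∨ z = c - h * I) : (z - c) ^ 2 + (h:ℂ) ^ 2 = 0 := by
  rcases he with rfl | rfl <;> linear_combination (h:ℂ) ^ 2 * Complex.I_sq

/-- structure of the central arc near its unique crossing of the real line -/
lemma center (H : Par c h ρ1 ρ2 τ1 τ2) {G : Set ℂ} (hG : Lev c h ρ1 ρ2 τ1 τ2 G)
    {γ : ℝ → ℂ} (hγ : ContDiff ℝ 1 γ) (hi : InjOn γ (Icc 0 1))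
    (hreg : ∀ t ∈ Icc (0:ℝ) 1, deriv γ t ≠ 0) (hm : ∀ t ∈ Icc (0:ℝ) 1, γ t ∈ G)
    (e0 : γ 0 = c + h * I) (e1 : γ 1 = c - h * I)
    (hc : ∀ t ∈ Icc (0:ℝ) 1, (γ t).im = 0 → -1 < (γ t).re ∧ (γ t).re < 1) :
    ∃ s ∈ Ioo (0:ℝ) 1, ∃ x κ : ℝ, γ s = x ∧ -1 < x ∧ x < 1 ∧ 0 < κ ∧ deriv γ s = -(κ * I) ∧
      (∀ t ∈ Icc (0:ℝ) 1, (γ t).im = 0 → t = s) ∧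
      ∀ y : ℝ, (y:ℂ) ∈ γ '' Icc 0 1 → y = x := by
  have hh := H.h0
  have i0 : (γ 0).im = h := by rw [e0]; simp
  have i1 : (γ 1).im = -h := by rw [e1]; simp
  obtain ⟨s, hs, hs0⟩ := exists_cross hγ.continuous
    (Or.inr ⟨by rw [i1]; linarith, by rw [i0]; linarith⟩)
  have hs' := Ioo_subset_Icc_self hs
  have hre : ∀ t, (γ t).im = 0 → γ t = (((γ t).re : ℝ) : ℂ) :=
    fun t ht => Complex.ext (by simp) (by simpa using ht)
  have huniq : ∀ t ∈ Icc (0:ℝ) 1, (γ t).im = 0 → t = s := by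
    intro t ht hti
    apply hi ht hs'
    rw [hre t hti, hre s hs0]
    have m1 : (((γ t).re : ℝ) : ℂ) ∈ G := hre t hti ▸ hm t ht
    have m2 : (((γ s).re : ℝ) : ℂ) ∈ G := hre s hs0 ▸ hm s hs'
    rcases lt_trichotomy (γ t).re (γ s).re with a | a | a
    · exact (real_unique H hG m1 m2 (hc t ht hti).1 a (hc s hs' hs0).2).elim
    · rw [a]
    · exact (real_unique H hG m2 m1 (hc s hs' hs0).1 a (hc t ht hti).2).elim
  have hneg : ∀ t ∈ Ioo s 1, (γ t).im < 0 := by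
    intro t ht
    by_contra hcon
    push Not at hcon
    have hcn : ContinuousOn (fun t => (γ t).im) (Icc t 1) :=
      (Complex.continuous_im.comp hγ.continuous).continuousOn
    obtain ⟨u, hu, hu0⟩ := intermediate_value_Icc' ht.2.le hcn
      (show (0:ℝ) ∈ Icc _ _ from ⟨by rw [i1]; linarith, hcon⟩)
    have := huniq u ⟨by linarith [hs.1, ht.1, hu.1], hu.2⟩ hu0
    linarith [ht.1, hu.1]
  have hx := hre s hs0
  obtain ⟨b1, b2⟩ := hc s hs' hs0
  set x := (γ s).re with hxdef
  have hd : HasDerivAt γ (deriv γ s) s :=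
    (hγ.differentiable one_ne_zero).differentiableAt.hasDerivAt
  -- the derivative has nonpositive imaginary part
  have him : (deriv γ s).im ≤ 0 := by
    have hdi : HasDerivAt (fun t => (γ t).im) (deriv γ s).im s := by
      have := Complex.imCLM.hasFDerivAt.comp_hasDerivAt s hd
      exact this
    have hsl := hdi.tendsto_slope
    have hsl2 : Tendsto (slope (fun t => (γ t).im) s) (𝓝[>] s) (𝓝 (deriv γ s).im) :=
      hsl.mono_left (nhdsWithin_mono _ (fun t ht => ne_of_gt ht))
    refine le_of_tendsto hsl2 ?_
    filter_upwards [Ioo_mem_nhdsGT hs.2] with t ht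
    rw [slope_def_field, hs0, sub_zero]
    exact (div_neg_of_neg_of_pos (hneg t ht) (by linarith [ht.1])).le
  -- the tangent is vertical
  have hre0 : (deriv γ s).re = 0 := by
    set q := Real.sqrt ((x - c) ^ 2 + h ^ 2) with hq
    have q0 : 0 < q := Real.sqrt_pos.2 (by positivity)
    have q2 : q ^ 2 = (x - c) ^ 2 + h ^ 2 := Real.sq_sqrt (by positivity)
    have hmev : ∀ᶠ t in 𝓝 s, γ t ∈ G := by
      filter_upwards [Icc_mem_nhds hs.1 hs.2] with t ht using hm t ht
    have T := tangent H hG (w0 := (q:ℂ)) hd hmev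
      (by rw [hx]; exact_mod_cast q2) (by exact_mod_cast q0.ne')
    have e : (q:ℂ) / (γ s ^ 2 - 1) = ((q / (x ^ 2 - 1) : ℝ) : ℂ) := by
      rw [hx]; push_cast; rfl
    rw [e, Complex.re_ofReal_mul] at T
    have : q / (x ^ 2 - 1) ≠ 0 := by
      apply div_ne_zero q0.ne'
      nlinarith
    exact (mul_eq_zero.1 T).resolve_left this
  refine ⟨s, hs, x, -(deriv γ s).im, hx, b1, b2, ?_, ?_, huniq, ?_⟩
  · rcases lt_or_eq_of_le him with a | a
    · linarith
    · exact (hreg s hs' (Complex.ext hre0 a)).elim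
  · apply Complex.ext
    · simp [hre0]
    · simp
  · rintro y ⟨t, ht, hty⟩
    have : t = s := huniq t ht (by rw [hty]; simp)
    rw [this, hx] at hty
    exact_mod_cast hty.symm

end par5

/-- values of `((A+B+2)/2) ∫_{ζ₋}^{ζ₊} R(t)/(t²−1) dt` along the four
possible paths.  Since `γL`, `γC` are oriented from `ζ₊` to `ζ₋`, traversing them from
`ζ₋` to `ζ₊` accounts for the minus signs. -/
theorem integral_from_zetaM_to_zetaP_four_paths
    (A B : ℝ) (hA : -1 < A) (hA0 : A < 0) (hB : -1 < B) (hB0 : B < 0)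
    (hAB : -2 < A + B) (hAB1 : A + B < -1)
    (γL γC γR : ℝ → ℂ) (harcs : ArcParam A B γL γC γR)
    (R : ℂ → ℂ) (hR : IsSqrtBranch A B γC R)
    (Rp : ℝ → ℂ) (hRp : IsPlusBoundary A B γC R Rp)
    (Rm : ℝ → ℂ) (hRm : IsMinusBoundary A B γC R Rm) :
    -- along Γ_R (oriented from ζ₋ to ζ₊)
    (((A:ℂ) + B + 2) / 2) *
        (∫ t in (0:ℝ)..1, R (γR t) / ((γR t) ^ 2 - 1) * deriv γR t) =
      Real.pi * Complex.I * ((1 + B : ℝ) : ℂ) ∧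
    -- along Γ_C traversed from ζ₋ to ζ₊, with the + boundary value R₊
    (((A:ℂ) + B + 2) / 2) *
        (-(∫ t in (0:ℝ)..1, Rp t / ((γC t) ^ 2 - 1) * deriv γC t)) =
      Real.pi * Complex.I * ((1 + A + B : ℝ) : ℂ) ∧
    -- along Γ_C traversed from ζ₋ to ζ₊, with the − boundary value R₋
    (((A:ℂ) + B + 2) / 2) *
        (-(∫ t in (0:ℝ)..1, Rm t / ((γC t) ^ 2 - 1) * deriv γC t)) =
      -(Real.pi * Complex.I * ((1 + A + B : ℝ) : ℂ)) ∧
    -- along Γ_L traversed from ζ₋ to ζ₊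
    (((A:ℂ) + B + 2) / 2) *
        (-(∫ t in (0:ℝ)..1, R (γL t) / ((γL t) ^ 2 - 1) * deriv γL t)) =
      -(Real.pi * Complex.I * ((1 + A : ℝ) : ℂ)) := by
  obtain ⟨c, h, ρ1, ρ2, τ1, τ2, H, hP, hM, r1, r2⟩ :=
    par_exists A B hA hA0 hB hB0 hAB hAB1
  have hh := H.h0
  have hG := lev_gamma H A B hP hM
  have hs : (A : ℂ) + B + 2 ≠ 0 := by
    have : A + B + 2 ≠ 0 := by linarith
    exact_mod_cast this
  have prodQ : ∀ z : ℂ, (z - zetaP A B) * (z - zetaM A B) = (z - c) ^ 2 + (h:ℂ) ^ 2 := by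
    intro z
    rw [hP, hM]
    linear_combination (-(h:ℂ) ^ 2) * Complex.I_sq
  have L0 := harcs.endL0
  have L1 := harcs.endL1
  have C0 := harcs.endC0
  have C1 := harcs.endC1
  have R0 := harcs.endR0
  have R1 := harcs.endR1
  rw [hP] at L0 C0 R1
  rw [hM] at L1 C1 R0
  have mL : ∀ t ∈ Icc (0:ℝ) 1, γL t ∈ GammaSet A B := by
    intro t ht; rw [← harcs.union]; exact Or.inl (Or.inl ⟨t, ht, rfl⟩)
  have mC : ∀ t ∈ Icc (0:ℝ) 1, γC t ∈ GammaSet A B := by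
    intro t ht; rw [← harcs.union]; exact Or.inl (Or.inr ⟨t, ht, rfl⟩)
  have mR : ∀ t ∈ Icc (0:ℝ) 1, γR t ∈ GammaSet A B := by
    intro t ht; rw [← harcs.union]; exact Or.inr ⟨t, ht, rfl⟩
  have nL : ∀ t ∈ Ioo (0:ℝ) 1, (γL t - c) ^ 2 + (h:ℂ) ^ 2 ≠ 0 :=
    fun t ht => Q_ne harcs.injL ht (Or.inl ⟨L0, L1⟩)
  have nC : ∀ t ∈ Ioo (0:ℝ) 1, (γC t - c) ^ 2 + (h:ℂ) ^ 2 ≠ 0 :=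
    fun t ht => Q_ne harcs.injC ht (Or.inl ⟨C0, C1⟩)
  have nR : ∀ t ∈ Ioo (0:ℝ) 1, (γR t - c) ^ 2 + (h:ℂ) ^ 2 ≠ 0 :=
    fun t ht => Q_ne harcs.injR ht (Or.inr ⟨R0, R1⟩)
  have hK : IsClosed (γC '' Icc 0 1) :=
    (isCompact_Icc.image harcs.smoothC.continuous).isClosed
  obtain ⟨hRd, hRs, hRt⟩ := hR
  have hRs' : ∀ z ∉ γC '' Icc 0 1, R z ^ 2 = (z - c) ^ 2 + (h:ℂ) ^ 2 := by
    intro z hz; rw [hRs z hz, prodQ]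
  obtain ⟨s, hs01, x, κ, hsx, x1, x2, κ0, hder, huniq, hreal⟩ :=
    center H hG harcs.smoothC harcs.injC harcs.regC mC C0 C1 harcs.crossC
  have hs01' := Ioo_subset_Icc_self hs01
  have Rpos : ∀ y : ℝ, x < y → 0 < (R y).re := fun y hy =>
    R_pos hh hK hRd hRs' hRt (x0 := x) (fun y' h1 h2 => h1.ne' (hreal y' h2)) hy
  have Rneg : ∀ y : ℝ, y < x → (R y).re < 0 := fun y hy =>
    R_neg hh hK hRd hRs' hRt (x0 := x) (fun y' h1 h2 => h1.ne (hreal y' h2)) hy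
  have iP : ((c:ℂ) + h * I).im = h := by simp
  have iM : ((c:ℂ) - h * I).im = -h := by simp
  have interior : ∀ γ : ℝ → ℂ, (γ 0).im ≠ 0 → (γ 1).im ≠ 0 → ∀ t ∈ Icc (0:ℝ) 1,
      (γ t).im = 0 → t ∈ Ioo (0:ℝ) 1 := by
    intro γ a b t ht hi
    refine ⟨lt_of_le_of_ne ht.1 ?_, lt_of_le_of_ne ht.2 ?_⟩
    · rintro rfl; exact a hi
    · rintro rfl; exact b hi
  have ofre : ∀ z : ℂ, z.im = 0 → z = ((z.re : ℝ) : ℂ) :=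
    fun z hz => Complex.ext (by simp) (by simpa using hz)
  -- the outer arcs do not meet the central one
  have dR : ∀ t ∈ Ioo (0:ℝ) 1, γR t ∉ γC '' Icc 0 1 := by
    refine disjoint_arcs H hG harcs.smoothR.continuous harcs.smoothC harcs.regC mR mC nR
      (Q_end (Or.inl C0)) (Q_end (Or.inr C1)) ?_
    obtain ⟨t, ht, ht0⟩ := exists_cross harcs.smoothR.continuous
      (Or.inl ⟨by rw [R0, iM]; linarith, by rw [R1, iP]; linarith⟩)
    refine ⟨t, ht, ?_⟩
    rintro ⟨u, hu, hut⟩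
    have a := harcs.crossR t (Ioo_subset_Icc_self ht) ht0
    have b := harcs.crossC u hu (by rw [hut]; exact ht0)
    rw [hut] at b
    linarith [b.2]
  have dL : ∀ t ∈ Ioo (0:ℝ) 1, γL t ∉ γC '' Icc 0 1 := by
    refine disjoint_arcs H hG harcs.smoothL.continuous harcs.smoothC harcs.regC mL mC nL
      (Q_end (Or.inl C0)) (Q_end (Or.inr C1)) ?_
    obtain ⟨t, ht, ht0⟩ := exists_cross harcs.smoothL.continuous
      (Or.inr ⟨by rw [L1, iM]; linarith, by rw [L0, iP]; linarith⟩)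
    refine ⟨t, ht, ?_⟩
    rintro ⟨u, hu, hut⟩
    have a := harcs.crossL t (Ioo_subset_Icc_self ht) ht0
    have b := harcs.crossC u hu (by rw [hut]; exact ht0)
    rw [hut] at b
    linarith [b.1]
  have nz : ∀ {w q : ℂ}, w ^ 2 = q → q ≠ 0 → w ≠ 0 := by
    intro w q hw hq hw0
    apply hq; rw [← hw, hw0]; simp
  -- the right arc
  have IR : (∫ t in (0:ℝ)..1, R (γR t) / ((γR t) ^ 2 - 1) * deriv γR t) =
      Real.pi * I * (1 + ρ1 / 2 - ρ2 / 2) := by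
    obtain ⟨g, hg, gsq, gI⟩ := arc_lift harcs.smoothR.continuous hK hRd hRs' dR
      (Q_end (Or.inr R0)) (Q_end (Or.inl R1))
    rw [← eval_R H harcs.smoothR hg gsq (fun t ht => (hG _ (mR t ht)).1)
      (fun t ht => nz (gsq t (Ioo_subset_Icc_self ht)) (nR t ht)) R0 R1 ?_]
    · apply integral_congr_Ioo'
      intro t ht; rw [gI t ht]
    · intro t ht hi
      have a := harcs.crossR t ht hi
      refine ⟨a, ?_⟩
      rw [gI t (interior γR (by rw [R0, iM]; linarith) (by rw [R1, iP]; linarith) t ht hi),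
        ofre _ hi]
      exact Rpos _ (by linarith)
  have IL : -(∫ t in (0:ℝ)..1, R (γL t) / ((γL t) ^ 2 - 1) * deriv γL t) =
      Real.pi * I * (-1 + ρ1 / 2 - ρ2 / 2) := by
    obtain ⟨g, hg, gsq, gI⟩ := arc_lift harcs.smoothL.continuous hK hRd hRs' dL
      (Q_end (Or.inl L0)) (Q_end (Or.inr L1))
    rw [← eval_L H harcs.smoothL hg gsq (fun t ht => (hG _ (mL t ht)).1)
      (fun t ht => nz (gsq t (Ioo_subset_Icc_self ht)) (nL t ht)) L0 L1 ?_]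
    · congr 1
      apply integral_congr_Ioo'
      intro t ht; rw [gI t ht]
    · intro t ht hi
      have a := harcs.crossL t ht hi
      refine ⟨a, ?_⟩
      rw [gI t (interior γL (by rw [L0, iP]; linarith) (by rw [L1, iM]; linarith) t ht hi),
        ofre _ hi]
      exact Rneg _ (by linarith)
  -- boundary values on the central arc
  have hline : ∀ ε : ℝ, γC s + (ε:ℂ) * (I * deriv γC s) = ((x + ε * κ : ℝ) : ℂ) := by
    intro ε
    rw [hsx, hder]; push_cast
    linear_combination (-(ε:ℂ) * κ) * Complex.I_sq
  obtain ⟨hp1, hp2, hp3⟩ := hRp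
  obtain ⟨hm1, hm2, hm3⟩ := hRm
  have psq : ∀ t ∈ Icc (0:ℝ) 1, Rp t ^ 2 = (γC t - c) ^ 2 + (h:ℂ) ^ 2 := by
    intro t ht; rw [hp2 t ht, prodQ]
  have msq : ∀ t ∈ Icc (0:ℝ) 1, Rm t ^ 2 = (γC t - c) ^ 2 + (h:ℂ) ^ 2 := by
    intro t ht; rw [hm2 t ht, prodQ]
  have pp : 0 < (Rp s).re := by
    have a := (Complex.continuous_re.tendsto _).comp (hp3 s hs01)
    have b : 0 ≤ (Rp s).re := by
      refine ge_of_tendsto a ?_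
      filter_upwards [self_mem_nhdsWithin] with ε hε
      have hε' : 0 < ε := hε
      simp only [Function.comp_apply]
      rw [hline]
      exact (Rpos _ (by linarith [mul_pos hε' κ0])).le
    have hq := psq s hs01'
    rw [hsx] at hq
    exact lt_of_le_of_ne b (real_sqrt_facts hh hq).2.symm
  have mm : (Rm s).re < 0 := by
    have a := (Complex.continuous_re.tendsto _).comp (hm3 s hs01)
    have b : (Rm s).re ≤ 0 := by
      refine le_of_tendsto a ?_
      filter_upwards [self_mem_nhdsWithin] with ε hε
      have hε' : ε < 0 := hε
      simp only [Function.comp_apply]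
      rw [hline]
      exact (Rneg _ (by linarith [mul_neg_of_neg_of_pos hε' κ0])).le
    have hq := msq s hs01'
    rw [hsx] at hq
    exact lt_of_le_of_ne b (real_sqrt_facts hh hq).2
  have IP := eval_C H harcs.smoothC hp1 psq (fun t ht => (hG _ (mC t ht)).1)
    (fun t ht => nz (psq t (Ioo_subset_Icc_self ht)) (nC t ht)) C0 C1
    (fun t ht hi => ⟨harcs.crossC t ht hi, by rw [huniq t ht hi]; exact pp⟩)
  have msq' : ∀ t ∈ Icc (0:ℝ) 1, (-Rm t) ^ 2 = (γC t - c) ^ 2 + (h:ℂ) ^ 2 := by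
    intro t ht; rw [neg_sq, msq t ht]
  have IM := eval_C H harcs.smoothC (g := fun t => -Rm t) hm1.neg msq'
    (fun t ht => (hG _ (mC t ht)).1)
    (fun t ht => nz (msq' t (Ioo_subset_Icc_self ht)) (nC t ht)) C0 C1
    (fun t ht hi => ⟨harcs.crossC t ht hi, by
      rw [huniq t ht hi, Complex.neg_re]; linarith⟩)
  have IM' : (∫ t in (0:ℝ)..1, Rm t / ((γC t) ^ 2 - 1) * deriv γC t) =
      Real.pi * I * (1 - ρ1 / 2 - ρ2 / 2) := by
    rw [← IM, ← intervalIntegral.integral_neg]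
    congr 1
    funext t
    ring
  rw [IR, IP, IM', IL, r1, r2]
  push_cast
  refine ⟨?_, ?_, ?_, ?_⟩ <;> field_simp <;> ring

end
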